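/- arXiv:2507.22184 — 3 statements merged into one kernel-verified Lean document; each statement's English description precedes it below -/
import Mathlib

section
/- Let F be a finite family of closed subsets of the n-sphere S^n that covers S^n and such that no set F in the family contains a pair of antipodal points (F ∩ -F = ∅), and let ≤ be a linear order on the family. Then there exists a point x ∈ S^n and sets F₁ < F₂ < ... < F_{n+2} in the family such that x ∈ (-1)^{i-1} F_i for each i = 1, ..., n+2 (i.e., x ∈ F₁, -x ∈ F₂, x ∈ F₃, etc.). -/
namespace ListChain

/-- Mod 2 chains whose simplices are finite lists of vertices. -/
abbrev Chain (X : Type*) := List X →₀ ZMod 2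

variable {X Y : Type*}

/-- The linear extension of a function on simplices. -/
noncomputable abbrev extend {M : Type*} [AddCommMonoid M] [Module (ZMod 2) M] (f : List X → M) :
    Chain X →ₗ[ZMod 2] M :=
  Finsupp.linearCombination (ZMod 2) f

/-- The cone operator, adjoining the vertex `x` to every simplex. -/
noncomputable def cone (x : X) : Chain X →ₗ[ZMod 2] Chain X :=
  Finsupp.lmapDomain (ZMod 2) (ZMod 2) (List.cons x)

/-- The chain map induced by a map of vertices. -/
noncomputable def push (f : X → Y) : Chain X →ₗ[ZMod 2] Chain Y :=
  Finsupp.lmapDomain (ZMod 2) (ZMod 2) (List.map f)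

/-- The sum of the faces of a simplex. -/
noncomputable def faces : List X → Chain X
  | [] => 0
  | x :: l => Finsupp.single l 1 + cone x (faces l)

/-- The augmented boundary operator. -/
noncomputable def boundary : Chain X →ₗ[ZMod 2] Chain X := extend faces

/-- The prism between the images of a simplex under `f` and `g`. -/
noncomputable def prismSimplex (f g : X → Y) : List X → Chain Y
  | [] => 0
  | x :: l => Finsupp.single (f x :: g x :: l.map g) 1 + cone (f x) (prismSimplex f g l)

/-- The prism operator of two maps of vertices. -/
noncomputable def prism (f g : X → Y) : Chain X →ₗ[ZMod 2] Chain Y := extend (prismSimplex f g)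

@[simp] lemma cone_single (x : X) (l : List X) (r : ZMod 2) :
    cone x (Finsupp.single l r) = Finsupp.single (x :: l) r := by
  simp [cone]

@[simp] lemma push_single (f : X → Y) (l : List X) (r : ZMod 2) :
    push f (Finsupp.single l r) = Finsupp.single (l.map f) r := by
  simp [push]

@[simp] lemma boundary_single (l : List X) : boundary (Finsupp.single l 1) = faces l := by
  simp [boundary]

@[simp] lemma prism_single (f g : X → Y) (l : List X) :
    prism f g (Finsupp.single l 1) = prismSimplex f g l := by
  simp [prism]

lemma linearMap_ext {M : Type*} [AddCommMonoid M] [Module (ZMod 2) M]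
    {S T : Chain X →ₗ[ZMod 2] M} (h : ∀ l, S (Finsupp.single l 1) = T (Finsupp.single l 1))
    (c : Chain X) : S c = T c := by
  have : S = T := by
    ext l
    simpa using h l
  rw [this]

lemma push_cone (f : X → Y) (x : X) (c : Chain X) :
    push f (cone x c) = cone (f x) (push f c) :=
  linearMap_ext (S := push f ∘ₗ cone x) (T := cone (f x) ∘ₗ push f) (fun l ↦ by simp) c

lemma push_comp {Z : Type*} (f : X → Y) (g : Y → Z) (c : Chain X) :
    push g (push f c) = push (g ∘ f) c :=
  linearMap_ext (S := push g ∘ₗ push f) (T := push (g ∘ f)) (fun l ↦ by simp) c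

lemma push_id (c : Chain X) : push id c = c :=
  linearMap_ext (S := push id) (T := LinearMap.id) (fun l ↦ by simp) c

lemma boundary_cone (x : X) (c : Chain X) :
    boundary (cone x c) = c + cone x (boundary c) :=
  linearMap_ext (S := boundary ∘ₗ cone x) (T := LinearMap.id + cone x ∘ₗ boundary)
    (fun l ↦ by simp [faces]) c

lemma boundary_push (f : X → Y) (c : Chain X) :
    boundary (push f c) = push f (boundary c) := by
  refine linearMap_ext (S := boundary ∘ₗ push f) (T := push f ∘ₗ boundary) (fun l ↦ ?_) c
  induction l with
  | nil => simp [faces]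
  | cons x l ih => simp_all [faces, push_cone]

lemma prism_cone (f g : X → Y) (x : X) (c : Chain X) :
    prism f g (cone x c) = cone (f x) (cone (g x) (push g c)) + cone (f x) (prism f g c) :=
  linearMap_ext (S := prism f g ∘ₗ cone x)
    (T := cone (f x) ∘ₗ cone (g x) ∘ₗ push g + cone (f x) ∘ₗ prism f g)
    (fun l ↦ by simp [prismSimplex]) c

lemma boundary_prism (f g : X → Y) (c : Chain X) :
    boundary (prism f g c) + prism f g (boundary c) = push g c + push f c := by
  refine linearMap_ext (S := boundary ∘ₗ prism f g + prism f g ∘ₗ boundary)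
    (T := push g + push f) (fun l ↦ ?_) c
  induction l with
  | nil => simp [faces, prismSimplex, ZModModule.add_self]
  | cons x l ih =>
    simp only [LinearMap.add_apply, LinearMap.comp_apply, prism_single, boundary_single,
      push_single, cone_single, List.map_cons, prismSimplex, faces, map_add, boundary_cone,
      prism_cone] at ih ⊢
    have h := congrArg (cone (f x)) ih
    have hp := boundary_push g (Finsupp.single l 1)
    simp only [map_add, cone_single, push_single, boundary_single] at h hp
    rw [hp]
    have e : ∀ u v w p r s t : Chain Y, r + s = v + w →
        (u + (v + t)) + (p + r) + (p + (t + s)) = u + w := by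
      intro u v w p r s t hrs
      calc _ = u + v + (r + s) + (t + t) + (p + p) := by abel
        _ = u + w + (v + v) := by rw [hrs, ZModModule.add_self, ZModModule.add_self]; abel
        _ = _ := by rw [ZModModule.add_self, add_zero]
    exact e _ _ _ _ _ _ _ h

lemma map_mem_of_mem_supported {M : Type*} [AddCommMonoid M] [Module (ZMod 2) M]
    {S : Set (List X)} {N : Submodule (ZMod 2) M} (T : Chain X →ₗ[ZMod 2] M)
    (h : ∀ l ∈ S, T (Finsupp.single l 1) ∈ N) {c : Chain X}
    (hc : c ∈ Finsupp.supported (ZMod 2) (ZMod 2) S) : T c ∈ N := by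
  rw [Finsupp.supported_eq_span_single] at hc
  have : Submodule.span (ZMod 2) ((fun i ↦ Finsupp.single i (1 : ZMod 2)) '' S) ≤ N.comap T := by
    rw [Submodule.span_le]
    rintro _ ⟨l, hl, rfl⟩
    exact h l hl
  exact this hc

lemma prismSimplex_mem_supported (f g : X → Y) (l : List X) :
    prismSimplex f g l ∈ Finsupp.supported (ZMod 2) (ZMod 2)
      {l' : List Y | l'.length = l.length + 1 ∧ ∀ y ∈ l', ∃ x ∈ l, y = f x ∨ y = g x} := by
  induction l with
  | nil => simp [prismSimplex]
  | cons x l ih =>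
    refine Submodule.add_mem _ (Finsupp.single_mem_supported _ _ ?_)
      (map_mem_of_mem_supported _ (fun l' hl' ↦ ?_) ih)
    · simp only [Set.mem_ofPred_eq, List.length_cons, List.length_map, true_and]
      intro y hy
      simp only [List.mem_cons, List.mem_map] at hy ⊢
      grind
    · rw [cone_single]
      refine Finsupp.single_mem_supported _ _ ?_
      simp only [Set.mem_ofPred_eq, List.length_cons, List.mem_cons] at hl' ⊢
      grind

lemma boundary_sum_prism (h : ℕ → X → Y) {z : Chain X} (hz : boundary z = 0) (N : ℕ) :
    boundary (∑ j ∈ Finset.range N, prism (h j) (h (j + 1)) z) = push (h N) z + push (h 0) z := by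
  induction N with
  | zero => simp [ZModModule.add_self]
  | succ N ih =>
    have hp := boundary_prism (h N) (h (N + 1)) z
    rw [hz, map_zero, add_zero] at hp
    rw [Finset.sum_range_succ, map_add, ih, hp]
    calc _ = push (h (N + 1)) z + push (h 0) z + (push (h N) z + push (h N) z) := by abel
      _ = _ := by rw [ZModModule.add_self, add_zero]

/-- A cycle is bounded by the track of a discrete homotopy starting at the identity, closed up by a
cone. -/
lemma boundary_track (h : ℕ → X → X) (h0 : h 0 = id) (e : X) {z : Chain X} (hz : boundary z = 0)
    (N : ℕ) :
    boundary (∑ j ∈ Finset.range N, prism (h j) (h (j + 1)) z + cone e (push (h N) z)) = z := by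
  rw [map_add, boundary_sum_prism h hz, boundary_cone, boundary_push, hz, h0, push_id]
  simp only [map_zero, add_zero]
  calc _ = z + (push (h N) z + push (h N) z) := by abel
    _ = z := by rw [ZModModule.add_self, add_zero]

lemma extend_faces_cons (f : List X → ZMod 2) (x : X) (l : List X) :
    extend f (faces (x :: l)) = f l + extend (fun l' ↦ f (x :: l')) (faces l) := by
  have : ∀ c, extend f (cone x c) = extend (fun l' ↦ f (x :: l')) c :=
    linearMap_ext (S := extend f ∘ₗ cone x) (T := extend fun l' ↦ f (x :: l')) (by simp)
  simp [faces, this]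

lemma extend_faces_perm (f : List X → ZMod 2) (hf : ∀ l l', l.Perm l' → f l = f l')
    {l l' : List X} (h : l.Perm l') : extend f (faces l) = extend f (faces l') := by
  induction h generalizing f with
  | nil => rfl
  | cons x h ih =>
    rw [extend_faces_cons, extend_faces_cons, hf _ _ h, ih _ fun _ _ h ↦ hf _ _ (h.cons x)]
  | swap x y l =>
    have : (fun l ↦ f (x :: y :: l)) = fun l ↦ f (y :: x :: l) :=
      funext fun l ↦ hf _ _ (List.Perm.swap ..)
    simp only [extend_faces_cons, this]
    ring
  | trans _ _ ih₁ ih₂ => rw [ih₁ f hf, ih₂ f hf]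

lemma extend_faces_congr {f g : List X → ZMod 2} {l : List X}
    (h : ∀ l', l'.Sublist l → f l' = g l') : extend f (faces l) = extend g (faces l) := by
  induction l generalizing f g with
  | nil => simp [faces]
  | cons x l ih =>
    rw [extend_faces_cons, extend_faces_cons, h l (List.sublist_cons_self x l),
      ih fun l' hl' ↦ h _ (hl'.cons_cons x)]

lemma extend_faces_map (p : X → Y) (f : List Y → ZMod 2) (l : List X) :
    extend f (faces (l.map p)) = extend (fun l' ↦ f (l'.map p)) (faces l) := by
  induction l generalizing f with
  | nil => simp [faces]
  | cons x l ih => simp only [List.map_cons, extend_faces_cons, ih]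

end ListChain

namespace KyFan

open ListChain

/-- The indicator, as an element of `ZMod 2`, of the alternating sign sequences starting with the
given sign. -/
def alt : Bool → List Bool → ZMod 2
  | _, [] => 1
  | b, s :: l => if s = b then alt (!b) l else 0

lemma extend_faces_alt (b : Bool) (l : List Bool) :
    extend (alt b) (faces l) = alt b l + alt (!b) l := by
  induction l generalizing b with
  | nil => simp [faces, alt, ZModModule.add_self]
  | cons s l ih =>
    rw [extend_faces_cons]
    by_cases h : s = b
    · have : (fun l' ↦ alt b (s :: l')) = alt (!b) := by
        funext l'
        simp [alt, h]
      rw [this, ih]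
      have h' : s ≠ !b := by cases b <;> simp_all
      rw [alt, alt, if_pos h, if_neg h', Bool.not_not]
      calc _ = alt (!b) l + (alt b l + alt b l) := by abel
        _ = _ := by rw [ZModModule.add_self]
    · have : (fun l' ↦ alt b (s :: l')) = fun _ ↦ 0 := by
        funext l'
        simp [alt, h]
      have h' : s = !b := by cases b <;> simp_all
      rw [this, alt, alt, if_neg h, if_pos h', Bool.not_not]
      simp [extend, Finsupp.linearCombination_apply]

lemma getElem_of_alt_ne_zero {b : Bool} {l : List Bool} (h : alt b l ≠ 0) (j : ℕ)
    (hj : j < l.length) : l[j] = if Even j then b else !b := by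
  induction l generalizing b j with
  | nil => simp at hj
  | cons s l ih =>
    have hs : s = b := by
      by_contra hs
      simp [alt, hs] at h
    rw [alt, if_pos hs] at h
    cases j with
    | zero => simpa using hs
    | succ j =>
      rw [List.getElem_cons_succ, ih h, Bool.not_not]
      by_cases hj : Even j <;> simp [hj, Nat.even_add_one]

variable {ι E : Type*} [LinearOrder ι]

/-- The labels of a simplex in increasing order. -/
def sortedLabels (lab : E → ι ×ₗ Bool) (l : List E) : List (ι ×ₗ Bool) :=
  Multiset.sort (l.map lab : Multiset (ι ×ₗ Bool))

/-- The indicator of the simplices with alternating labels, the smallest one having sign `b`. -/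
def altCount (lab : E → ι ×ₗ Bool) (b : Bool) (l : List E) : ZMod 2 :=
  alt b ((sortedLabels lab l).map fun p ↦ (ofLex p).2)

lemma extend_faces_altCount (lab : E → ι ×ₗ Bool) (b : Bool) (l : List E) :
    extend (altCount lab b) (faces l) = altCount lab b l + altCount lab (!b) l := by
  let s : List (ι ×ₗ Bool) → List (ι ×ₗ Bool) := fun L ↦ Multiset.sort (L : Multiset (ι ×ₗ Bool))
  have hs : ∀ L : List (ι ×ₗ Bool), L.Pairwise (· ≤ ·) → s L = L := fun L hL ↦
    List.mergeSort_of_pairwise (by simpa using hL)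
  let f : List (ι ×ₗ Bool) → ZMod 2 := fun L ↦ alt b ((s L).map fun p ↦ (ofLex p).2)
  have hsort : (s (l.map lab)).Pairwise (· ≤ ·) := Multiset.pairwise_sort _ _
  have hf : ∀ L L' : List (ι ×ₗ Bool), L.Perm L' → f L = f L' := by
    intro L L' h
    simp only [f, s, Multiset.coe_eq_coe.2 h]
  have hperm : (l.map lab).Perm (s (l.map lab)) :=
    (Multiset.coe_eq_coe.1 (Multiset.sort_eq _ _)).symm
  calc extend (altCount lab b) (faces l) = extend f (faces (l.map lab)) :=
        (extend_faces_map lab f l).symm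
    _ = extend f (faces (s (l.map lab))) := extend_faces_perm f hf hperm
    _ = extend (fun L ↦ alt b (L.map fun p ↦ (ofLex p).2)) (faces (s (l.map lab))) :=
        extend_faces_congr fun L hL ↦ by simp only [f, hs L (hsort.sublist hL)]
    _ = _ := by rw [← extend_faces_map, extend_faces_alt]; rfl

/-- The label with the same index and the opposite sign. -/
def flip (p : ι ×ₗ Bool) : ι ×ₗ Bool := toLex ((ofLex p).1, !(ofLex p).2)

lemma alt_map_not (b : Bool) (l : List Bool) : alt b (l.map (!·)) = alt (!b) l := by
  induction l generalizing b with
  | nil => rfl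
  | cons s l ih =>
    simp only [List.map_cons, alt, ih]
    cases s <;> cases b <;> rfl

lemma altCount_map_neg [Neg E] (lab : E → ι ×ₗ Bool) (b : Bool) (l : List E)
    (hneg : ∀ x ∈ l, lab (-x) = flip (lab x))
    (hcomp : ∀ x ∈ l, ∀ y ∈ l, lab x ≠ flip (lab y)) :
    altCount lab b (l.map Neg.neg) = altCount lab (!b) l := by
  have key : sortedLabels lab (l.map Neg.neg) = (sortedLabels lab l).map flip := by
    have h1 : ((l.map Neg.neg).map lab : Multiset (ι ×ₗ Bool)) =
        ((l.map lab : Multiset (ι ×ₗ Bool))).map flip := by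
      simp only [List.map_map, Multiset.map_coe, Multiset.coe_eq_coe]
      exact .of_eq (List.map_congr_left hneg)
    unfold sortedLabels
    rw [h1]
    symm
    apply Multiset.map_sort
    intro p hp q hq
    obtain ⟨x, hx, rfl⟩ : ∃ x ∈ l, lab x = p := by simpa using hp
    obtain ⟨y, hy, rfl⟩ : ∃ x ∈ l, lab x = q := by simpa using hq
    have h := hcomp x hx y hy
    simp only [flip, Prod.Lex.le_iff, ofLex_toLex]
    rcases hp : lab x with ⟨i, s⟩
    rcases hq : lab y with ⟨j, t⟩
    rw [hp, hq] at h
    have h' : i = j → s = t := by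
      rintro rfl
      by_contra hst
      apply h
      have : s = !t := by cases s <;> cases t <;> simp_all
      rw [this]
      rfl
    change i < j ∨ i = j ∧ s ≤ t ↔ i < j ∨ i = j ∧ (!s) ≤ (!t)
    grind
  rw [altCount, altCount, key, List.map_map, ← alt_map_not, List.map_map]
  rfl

/-- A simplex with alternating labels and no complementary pair of labels has its labels strictly
increasing in index. -/
lemma exists_strictMono_of_altCount_ne_zero (lab : E → ι ×ₗ Bool) {b : Bool} {l : List E} {m : ℕ}
    (hl : l.length = m) (h : altCount lab b l ≠ 0)
    (hcomp : ∀ x ∈ l, ∀ y ∈ l, lab x ≠ flip (lab y)) :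
    ∃ g : Fin m → ι, StrictMono g ∧
      ∀ j : Fin m, ∃ x ∈ l, lab x = toLex (g j, if Even (j : ℕ) then b else !b) := by
  have hlen : (sortedLabels lab l).length = m := by simp [sortedLabels, hl]
  have hmem : ∀ p ∈ sortedLabels lab l, ∃ x ∈ l, lab x = p := by
    intro p hp
    simpa [sortedLabels] using hp
  have hpw : (sortedLabels lab l).Pairwise (· ≤ ·) := Multiset.pairwise_sort _ _
  have hsign (j : ℕ) (hj : j < (sortedLabels lab l).length) :
      (ofLex (sortedLabels lab l)[j]).2 = if Even j then b else !b := by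
    have := getElem_of_alt_ne_zero h j (by simpa using hj)
    rwa [List.getElem_map] at this
  cases m with
  | zero => exact ⟨Fin.elim0, fun a ↦ a.elim0, fun a ↦ a.elim0⟩
  | succ m =>
  refine ⟨fun j ↦ (ofLex ((sortedLabels lab l)[(j : ℕ)]'(by omega))).1, ?_, fun j ↦ ?_⟩
  · rw [Fin.strictMono_iff_lt_succ]
    intro j
    simp only [Fin.val_castSucc, Fin.val_succ]
    have hle := List.pairwise_iff_getElem.1 hpw j (j + 1) (by omega) (by omega) (by omega)
    have s1 := hsign j (by omega)
    have s2 := hsign (j + 1) (by omega)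
    obtain ⟨x, hx, hxl⟩ := hmem _ (List.getElem_mem (n := (j : ℕ)) (by omega))
    obtain ⟨y, hy, hyl⟩ := hmem _ (List.getElem_mem (n := (j + 1 : ℕ)) (by omega))
    rcases Prod.Lex.le_iff.1 hle with hlt | ⟨heq, -⟩
    · exact hlt
    · refine absurd ?_ (hcomp x hx y hy)
      rw [hxl, hyl]
      refine ofLex.injective (Prod.ext heq ?_)
      rw [s1, flip, ofLex_toLex, s2]
      by_cases hj : Even (j : ℕ) <;> simp [hj, Nat.even_add_one]
  · obtain ⟨x, hx, hxl⟩ := hmem _ (List.getElem_mem (n := (j : ℕ)) (by omega))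
    refine ⟨x, hx, ?_⟩
    rw [hxl, ← hsign j (by omega)]
    rfl

end KyFan

namespace KyFan

open ListChain

section Rotation

variable {V : Type*} [NormedAddCommGroup V] [InnerProductSpace ℝ V]

/-- Rotation by the angle `t` towards the unit vector `e`, for vectors orthogonal to `e`. -/
noncomputable def rotate (e : V) (t : ℝ) (x : V) : V := Real.cos t • x + Real.sin t • e

lemma norm_rotate {e x : V} (t : ℝ) (he : ‖e‖ = 1) (hx : ‖x‖ = 1) (h : inner ℝ x e = 0) :
    ‖rotate e t x‖ = 1 := by
  have h2 : ‖rotate e t x‖ ^ 2 = 1 := by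
    rw [rotate, norm_add_sq_real, norm_smul, norm_smul, inner_smul_left, inner_smul_right, h, he,
      hx, Real.norm_eq_abs, Real.norm_eq_abs]
    simp
  nlinarith [norm_nonneg (rotate e t x)]

lemma dist_rotate_le_left (e x y : V) (t : ℝ) : dist (rotate e t x) (rotate e t y) ≤ dist x y := by
  rw [rotate, rotate, dist_add_right, dist_smul₀, Real.norm_eq_abs]
  exact mul_le_of_le_one_left dist_nonneg (Real.abs_cos_le_one t)

lemma dist_rotate_le_right {e x : V} (he : ‖e‖ = 1) (hx : ‖x‖ = 1) (s t : ℝ) :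
    dist (rotate e s x) (rotate e t x) ≤ 2 * |s - t| := by
  have h : rotate e s x - rotate e t x =
      (Real.cos s - Real.cos t) • x + (Real.sin s - Real.sin t) • e := by
    simp only [rotate, sub_smul]
    abel
  rw [dist_eq_norm, h]
  refine (norm_add_le _ _).trans ?_
  rw [norm_smul, norm_smul, he, hx, Real.norm_eq_abs, Real.norm_eq_abs]
  linarith [Real.abs_cos_sub_cos_le s t, Real.abs_sin_sub_sin_le s t]

lemma dist_rotate_le {e x y : V} (he : ‖e‖ = 1) (hy : ‖y‖ = 1) (s t : ℝ) :
    dist (rotate e s x) (rotate e t y) ≤ dist x y + 2 * |s - t| :=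
  (dist_triangle _ (rotate e s y) _).trans
    (add_le_add (dist_rotate_le_left e x y s) (dist_rotate_le_right he hy s t))

end Rotation

/-- The `k`-simplices of diameter at most `r` with vertices on the unit sphere of the span of the
first `k + 1` coordinate vectors. -/
def smallSimplices (n k : ℕ) (r : ℝ) : Set (List (EuclideanSpace ℝ (Fin (n + 1)))) :=
  {l | l.length = k + 1 ∧ (∀ x ∈ l, ‖x‖ = 1 ∧ ∀ i : Fin (n + 1), k < i → x i = 0) ∧
    ∀ x ∈ l, ∀ y ∈ l, dist x y ≤ r}

variable {n : ℕ}

lemma push_neg_mem_supported {k : ℕ} {r : ℝ} {c : Chain (EuclideanSpace ℝ (Fin (n + 1)))}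
    (hc : c ∈ Finsupp.supported (ZMod 2) (ZMod 2) (smallSimplices n k r)) :
    push Neg.neg c ∈ Finsupp.supported (ZMod 2) (ZMod 2) (smallSimplices n k r) := by
  refine map_mem_of_mem_supported _ (fun l hl ↦ ?_) hc
  rw [push_single]
  refine Finsupp.single_mem_supported _ _ ⟨by simpa using hl.1, ?_, ?_⟩
  · rw [List.forall_mem_map]
    simpa using! hl.2.1
  · simp_rw [List.forall_mem_map]
    simpa using! hl.2.2

lemma rotate_single_props {k : ℕ} (hk : k < n) (t : ℝ) {x : EuclideanSpace ℝ (Fin (n + 1))}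
    (hx : ‖x‖ = 1 ∧ ∀ i : Fin (n + 1), k < i → x i = 0) :
    ‖rotate (EuclideanSpace.single ⟨k + 1, by omega⟩ (1 : ℝ)) t x‖ = 1 ∧
      ∀ i : Fin (n + 1), k + 1 < i →
        rotate (EuclideanSpace.single ⟨k + 1, by omega⟩ (1 : ℝ)) t x i = 0 := by
  refine ⟨norm_rotate t (by simp) hx.1 ?_, fun i hi ↦ ?_⟩
  · rw [EuclideanSpace.inner_single_right]
    simp [hx.2 ⟨k + 1, by omega⟩ (by simp)]
  · have : i ≠ ⟨k + 1, by omega⟩ := by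
      intro h
      simp [h] at hi
    simp [rotate, hx.2 i (by omega), this]

/-- Cycles of small simplices on an equator bound chains of slightly larger simplices. -/
lemma exists_boundary_eq {k : ℕ} (hk : k < n) {r δ : ℝ} (hr : 0 ≤ r) (hδ : 0 < δ)
    {z : Chain (EuclideanSpace ℝ (Fin (n + 1)))}
    (hz : z ∈ Finsupp.supported (ZMod 2) (ZMod 2) (smallSimplices n k r))
    (hbz : boundary z = 0) :
    ∃ c ∈ Finsupp.supported (ZMod 2) (ZMod 2) (smallSimplices n (k + 1) (r + δ)),
      boundary c = z := by
  set e : EuclideanSpace ℝ (Fin (n + 1)) := EuclideanSpace.single ⟨k + 1, by omega⟩ (1 : ℝ) with he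
  have he1 : ‖e‖ = 1 := by simp [he]
  obtain ⟨N, hN⟩ := exists_nat_gt (Real.pi / δ)
  have hNpos : (0 : ℝ) < N := (div_pos Real.pi_pos hδ).trans hN
  let h : ℕ → EuclideanSpace ℝ (Fin (n + 1)) → EuclideanSpace ℝ (Fin (n + 1)) :=
    fun j ↦ rotate e (j * (Real.pi / 2 / N))
  have h0 : h 0 = id := by
    funext x
    simp [h, rotate]
  have hlast : ∀ x, h N x = e := by
    intro x
    have : (N : ℝ) * (Real.pi / 2 / N) = Real.pi / 2 := by field_simp
    simp [h, rotate, this]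
  have hstep : 2 * (Real.pi / 2 / N) ≤ δ := by
    rw [div_lt_iff₀ hδ] at hN
    rw [show 2 * (Real.pi / 2 / N) = Real.pi / N by ring, div_le_iff₀ hNpos]
    linarith
  refine ⟨_, ?_, boundary_track h h0 e hbz N⟩
  refine Submodule.add_mem _ (Submodule.sum_mem _ fun j _ ↦ ?_) ?_
  · refine map_mem_of_mem_supported _ (fun l hl ↦ ?_) hz
    rw [prism_single]
    refine Finsupp.supported_mono ?_ (prismSimplex_mem_supported (h j) (h (j + 1)) l)
    rintro l' ⟨hlen, hmem⟩
    have hform : ∀ y ∈ l', ∃ x ∈ l, ∃ s ∈ ({(j : ℝ), (j : ℝ) + 1} : Set ℝ),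
        y = rotate e (s * (Real.pi / 2 / N)) x := by
      intro y hy
      obtain ⟨x, hx, rfl | rfl⟩ := hmem y hy
      · exact ⟨x, hx, j, by simp, rfl⟩
      · exact ⟨x, hx, j + 1, by simp, by simp [h]⟩
    refine ⟨by rw [hlen, hl.1], fun y hy ↦ ?_, fun y hy y' hy' ↦ ?_⟩
    · obtain ⟨x, hx, s, -, rfl⟩ := hform y hy
      exact rotate_single_props hk _ (hl.2.1 x hx)
    · obtain ⟨x, hx, s, hs, rfl⟩ := hform y hy
      obtain ⟨x', hx', s', hs', rfl⟩ := hform y' hy'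
      refine (dist_rotate_le he1 (hl.2.1 x' hx').1 _ _).trans
        (add_le_add (hl.2.2 x hx x' hx') (le_trans ?_ hstep))
      rw [← sub_mul, abs_mul, abs_of_nonneg (show 0 ≤ Real.pi / 2 / N by positivity)]
      have hss : |s - s'| ≤ 1 := by
        rcases hs with rfl | rfl <;> rcases hs' with rfl | rfl <;> simp
      have := mul_le_mul_of_nonneg_right hss (show 0 ≤ Real.pi / 2 / N by positivity)
      linarith
  · refine map_mem_of_mem_supported (cone e ∘ₗ push (h N)) (fun l hl ↦ ?_) hz
    simp only [LinearMap.comp_apply, push_single, cone_single]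
    have hall : ∀ y ∈ e :: l.map (h N), y = e := by
      simp [hlast]
    refine Finsupp.single_mem_supported _ _ ⟨by simp [hl.1], fun y hy ↦ ?_, fun y hy y' hy' ↦ ?_⟩
    · rw [hall y hy]
      refine ⟨he1, fun i hi ↦ ?_⟩
      have : i ≠ ⟨k + 1, by omega⟩ := by
        intro h
        simp [h] at hi
      simp [he, this]
    · rw [hall y hy, hall y' hy', dist_self]
      linarith

/-- The counting argument behind Ky Fan's lemma, for abstract mod 2 weights `a`, `b` on simplices
that are exchanged by the antipodal map. -/
theorem exists_small_simplex_weight_ne_zero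
    (a b : List (EuclideanSpace ℝ (Fin (n + 1))) → ZMod 2) {ε : ℝ} (hε : 0 < ε) (hnil : a [] = 1)
    (hfaces : ∀ l, extend a (faces l) = a l + b l)
    (hneg : ∀ l, (∀ x ∈ l, ‖x‖ = 1) → (∀ x ∈ l, ∀ y ∈ l, dist x y < ε) →
      a (l.map Neg.neg) = b l) :
    ∃ l : List (EuclideanSpace ℝ (Fin (n + 1))), l.length = n + 1 ∧ (∀ x ∈ l, ‖x‖ = 1) ∧
      (∀ x ∈ l, ∀ y ∈ l, dist x y < ε) ∧ a l + b l ≠ 0 := by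
  set δ : ℝ := ε / (n + 1) with hδdef
  have hδ : 0 < δ := by positivity
  have hlt : ∀ k ≤ n, k * δ < ε := by
    intro k hk
    have : (k : ℝ) ≤ n := by exact_mod_cast hk
    rw [hδdef, mul_div_assoc', div_lt_iff₀ (by positivity)]
    nlinarith
  have hB : ∀ c, extend a (boundary c) = extend a c + extend b c :=
    linearMap_ext (S := extend a ∘ₗ boundary) (T := extend a + extend b)
      (fun l ↦ by simpa using hfaces l)
  have hN : ∀ k ≤ n, ∀ c ∈ Finsupp.supported (ZMod 2) (ZMod 2) (smallSimplices n k (k * δ)),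
      extend a (push Neg.neg c) = extend b c := by
    intro k hk c hc
    have : (extend a ∘ₗ push Neg.neg - extend b) c ∈ (⊥ : Submodule (ZMod 2) (ZMod 2)) := by
      refine map_mem_of_mem_supported _ (fun l hl ↦ ?_) hc
      have := hneg l (fun x hx ↦ (hl.2.1 x hx).1)
        fun x hx y hy ↦ (hl.2.2 x hx y hy).trans_lt (hlt k hk)
      simp [this]
    simpa [sub_eq_zero] using this
  have hnn : ∀ c : Chain (EuclideanSpace ℝ (Fin (n + 1))), push Neg.neg (push Neg.neg c) = c := by
    intro c
    rw [push_comp, show (Neg.neg ∘ Neg.neg : EuclideanSpace ℝ (Fin (n + 1)) → _) = id by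
      funext x; simp, push_id]
  have main : ∀ k ≤ n, ∃ c ∈ Finsupp.supported (ZMod 2) (ZMod 2) (smallSimplices n k (k * δ)),
      boundary (c + push Neg.neg c) = 0 ∧ extend a c + extend b c = 1 := by
    intro k
    induction k with
    | zero =>
      intro _
      refine ⟨Finsupp.single [EuclideanSpace.single 0 1] 1,
        Finsupp.single_mem_supported _ _ ?_, ?_, ?_⟩
      · simp only [smallSimplices, Set.mem_ofPred_eq, List.mem_singleton, forall_eq]
        refine ⟨rfl, ⟨by simp, fun i hi ↦ ?_⟩, by simp⟩
        have : i ≠ 0 := by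
          rintro rfl
          simp at hi
        simp [this]
      · rw [map_add, boundary_push]
        simp [faces, ZModModule.add_self]
      · rw [← hB]
        simp [faces, hnil]
    | succ k ih =>
      intro hk
      obtain ⟨c, hc, hbc, hab⟩ := ih (by omega)
      obtain ⟨c', hc', hbc'⟩ := exists_boundary_eq (by omega) (by positivity) hδ
        (Submodule.add_mem _ hc (push_neg_mem_supported hc)) hbc
      refine ⟨c', ?_, ?_, ?_⟩
      · convert hc' using 3
        push_cast
        ring
      · rw [map_add, boundary_push, hbc', map_add, hnn, add_comm (push _ c), ZModModule.add_self]
      · rw [← hB, hbc', map_add, hN k (by omega) c hc, hab]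
  obtain ⟨c, hc, -, hab⟩ := main n le_rfl
  by_contra! hcon
  have : (extend a + extend b) c ∈ (⊥ : Submodule (ZMod 2) (ZMod 2)) := by
    refine map_mem_of_mem_supported _ (fun l hl ↦ ?_) hc
    have := hcon l hl.1 (fun x hx ↦ (hl.2.1 x hx).1)
      fun x hx y hy ↦ (hl.2.2 x hx y hy).trans_lt (hlt n le_rfl)
    simpa using this
  rw [Submodule.mem_bot, LinearMap.add_apply, hab] at this
  exact one_ne_zero this

end KyFan

namespace KyFan

/-- A uniform version of the fact that a point of a closed set of a finite family that is close
enough to `x` forces `x` into that set. -/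
lemma exists_uniform_radius {X κ : Type*} [PseudoMetricSpace X] [Finite κ] {K : Set X}
    (hK : IsCompact K) (A : κ → Set X) (hA : ∀ i, IsClosed (A i)) :
    ∃ ε > 0, ∀ x ∈ K, ∃ y, ∀ z, dist z x < ε → ∀ i, z ∈ A i → y ∈ A i := by
  let U : X → Set X := fun y ↦ ⋂ i, {z | z ∈ A i → y ∈ A i}
  have hU : ∀ y, IsOpen (U y) := by
    refine fun y ↦ isOpen_iInter_of_finite fun i ↦ ?_
    by_cases hy : y ∈ A i
    · simp [hy]
    · simp only [hy, imp_false]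
      exact (hA i).isOpen_compl
  obtain ⟨ε, hε, h⟩ := lebesgue_number_lemma_of_metric hK hU
    fun x _ ↦ Set.mem_iUnion.2 ⟨x, by simp [U]⟩
  refine ⟨ε, hε, fun x hx ↦ ?_⟩
  obtain ⟨y, hy⟩ := h x hx
  exact ⟨y, fun z hz i hzi ↦ Set.mem_iInter.1 (hy (Metric.mem_ball.2 hz)) i hzi⟩

/-- Labels on the sphere: the sign of the label of `x` says which of `x` and `-x` lies in the set
named by the index, and the other one lies in a set of larger index. -/
lemma exists_labelling {V ι : Type*} [NormedAddCommGroup V] [Nonempty ι] [LinearOrder ι]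
    (F : ι → Set V) (hcover : Metric.sphere (0 : V) 1 ⊆ ⋃ i, F i)
    (hanti : ∀ i, F i ∩ (-F i) = ∅) :
    ∃ lab : V → ι ×ₗ Bool, ∀ x, ‖x‖ = 1 →
      lab (-x) = flip (lab x) ∧
      ∃ j, (ofLex (lab x)).1 < j ∧
        if (ofLex (lab x)).2 then x ∈ F (ofLex (lab x)).1 ∧ -x ∈ F j
        else -x ∈ F (ofLex (lab x)).1 ∧ x ∈ F j := by
  classical
  have hmem : ∀ x : V, ‖x‖ = 1 → ∃ i, x ∈ F i := fun x hx ↦ by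
    simpa using hcover (show x ∈ Metric.sphere (0 : V) 1 by simpa using hx)
  have hmem' : ∀ x : V, ∃ i, ‖x‖ = 1 → x ∈ F i := fun x ↦ by
    by_cases hx : ‖x‖ = 1
    · exact (hmem x hx).imp fun i hi _ ↦ hi
    · exact ⟨Classical.arbitrary ι, fun h ↦ absurd h hx⟩
  choose i hi using hmem'
  have hi' : ∀ x, ‖x‖ = 1 → -x ∈ F (i (-x)) := fun x hx ↦ hi (-x) (by simpa using hx)
  have hdiff : ∀ x, ‖x‖ = 1 → i x ≠ i (-x) := by
    intro x hx h
    have : x ∈ F (i x) ∩ -F (i x) := ⟨hi x hx, by simpa [h] using hi' x hx⟩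
    rw [hanti] at this
    exact this
  refine ⟨fun x ↦ if i x < i (-x) then toLex (i x, true) else toLex (i (-x), false),
    fun x hx ↦ ?_⟩
  rcases lt_or_gt_of_ne (hdiff x hx) with h | h
  · refine ⟨by simp [h, h.not_gt, flip], i (-x), ?_⟩
    simp [h, hi x hx, hi' x hx]
  · refine ⟨by simp [h, h.not_gt, flip], i x, ?_⟩
    simp [h, h.not_gt, hi x hx, hi' x hx]

end KyFan

/-- Ky Fan's covering lemma: a finite closed antipodal-free cover of `S^n`,
linearly ordered, admits a point witnessing an alternating pattern of length `n + 2`. -/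
theorem kyFan_covering_lemma {n : ℕ} {ι : Type*} [Fintype ι] [LinearOrder ι]
    (F : ι → Set (EuclideanSpace ℝ (Fin (n + 1))))
    (hclosed : ∀ i, IsClosed (F i))
    (hsub : ∀ i, F i ⊆ Metric.sphere (0 : EuclideanSpace ℝ (Fin (n + 1))) 1)
    (hcover : Metric.sphere (0 : EuclideanSpace ℝ (Fin (n + 1))) 1 ⊆ ⋃ i, F i)
    (hanti : ∀ i, F i ∩ (-F i) = ∅) :
    ∃ x ∈ Metric.sphere (0 : EuclideanSpace ℝ (Fin (n + 1))) 1,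
      ∃ g : Fin (n + 2) → ι, StrictMono g ∧
        ∀ i : Fin (n + 2), ((-1 : ℝ) ^ (i : ℕ)) • x ∈ F (g i) := by
  have hι : Nonempty ι := by
    have h : EuclideanSpace.single (0 : Fin (n + 1)) (1 : ℝ) ∈ ⋃ i, F i := hcover (by simp)
    obtain ⟨i, -⟩ := Set.mem_iUnion.1 h
    exact ⟨i⟩
  obtain ⟨lab, hlab⟩ := KyFan.exists_labelling F hcover hanti
  obtain ⟨ε, hε, hrad⟩ := KyFan.exists_uniform_radius
    (isCompact_sphere (0 : EuclideanSpace ℝ (Fin (n + 1))) 1)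
    (fun p : ι × Bool ↦ if p.2 then F p.1 else -F p.1) (fun p ↦ by
      split_ifs
      · exact hclosed _
      · exact (hclosed _).neg)
  replace hrad : ∀ l : List (EuclideanSpace ℝ (Fin (n + 1))), (∀ x ∈ l, ‖x‖ = 1) →
      (∀ x ∈ l, ∀ y ∈ l, dist x y < ε) →
      ∃ y, ∀ z ∈ l, ∀ i, (z ∈ F i → y ∈ F i) ∧ (-z ∈ F i → -y ∈ F i) := by
    intro l hl hd
    cases l with
    | nil => simp
    | cons x l =>
      obtain ⟨y, hy⟩ := hrad x (mem_sphere_zero_iff_norm.2 (hl x List.mem_cons_self))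
      refine ⟨y, fun z hz i ↦ ⟨?_, ?_⟩⟩
      · simpa using hy z (hd z hz x List.mem_cons_self) (i, true)
      · simpa using hy z (hd z hz x List.mem_cons_self) (i, false)
  have hcomp : ∀ l : List (EuclideanSpace ℝ (Fin (n + 1))), (∀ x ∈ l, ‖x‖ = 1) →
      (∀ x ∈ l, ∀ y ∈ l, dist x y < ε) → ∀ x ∈ l, ∀ y ∈ l, lab x ≠ KyFan.flip (lab y) := by
    intro l hl hd x hx y hy hxy
    obtain ⟨w, hw⟩ := hrad l hl hd
    obtain ⟨-, j, -, h⟩ := hlab x (hl x hx)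
    obtain ⟨-, j', -, h'⟩ := hlab y (hl y hy)
    have hF : ∀ i, w ∈ F i → -w ∉ F i := by
      intro i h1 h2
      exact Set.eq_empty_iff_forall_notMem.1 (hanti i) w ⟨h1, Set.mem_neg.2 h2⟩
    rw [hxy] at h
    simp only [KyFan.flip, ofLex_toLex] at h
    cases hs : (ofLex (lab y)).2
    · simp only [hs, Bool.not_false, if_true, Bool.false_eq_true, if_false] at h h'
      exact hF _ ((hw x hx _).1 h.1) ((hw y hy _).2 h'.1)
    · simp only [hs, Bool.not_true, if_true, Bool.false_eq_true, if_false] at h h'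
      exact hF _ ((hw y hy _).1 h'.1) ((hw x hx _).2 h.1)
  obtain ⟨l, hlen, hunit, hdist, hne⟩ := KyFan.exists_small_simplex_weight_ne_zero
    (KyFan.altCount lab true) (KyFan.altCount lab false) hε
    (by simp [KyFan.altCount, KyFan.sortedLabels, KyFan.alt])
    (KyFan.extend_faces_altCount lab true)
    (fun l hl hd ↦ KyFan.altCount_map_neg lab true l (fun x hx ↦ (hlab x (hl x hx)).1)
      (hcomp l hl hd))
  obtain ⟨b, hb⟩ : ∃ b, KyFan.altCount lab b l ≠ 0 := by
    by_contra! h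
    simp [h] at hne
  obtain ⟨y, hy⟩ := hrad l hunit hdist
  obtain ⟨g, hg, hgl⟩ := KyFan.exists_strictMono_of_altCount_ne_zero lab hlen hb
    (hcomp l hunit hdist)
  obtain ⟨v, hv, hvl⟩ := hgl (Fin.last n)
  obtain ⟨-, J, hJ, hvF⟩ := hlab v (hunit v hv)
  rw [Fin.val_last] at hvl
  simp only [hvl, ofLex_toLex] at hJ hvF
  let w := if b then y else -y
  have hgF : ∀ j : Fin (n + 1), ((-1 : ℝ) ^ (j : ℕ)) • w ∈ F (g j) := by
    intro j
    obtain ⟨x, hx, hxl⟩ := hgl j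
    obtain ⟨-, _, -, h⟩ := hlab x (hunit x hx)
    simp only [hxl, ofLex_toLex] at h
    have hyx := hy x hx (g j)
    by_cases hj : Even (j : ℕ)
    · rw [if_pos hj] at h
      rw [hj.neg_one_pow, one_smul]
      cases b
      · exact hyx.2 h.1
      · exact hyx.1 h.1
    · rw [if_neg hj] at h
      rw [(Nat.not_even_iff_odd.1 hj).neg_one_pow, neg_one_smul]
      cases b
      · simpa [w] using hyx.1 h.1
      · exact hyx.2 h.1
  have hJF : ((-1 : ℝ) ^ (n + 1)) • w ∈ F J := by
    have hyv := hy v hv J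
    by_cases hn : Even n
    · rw [if_pos hn] at hvF
      rw [hn.add_one.neg_one_pow, neg_one_smul]
      cases b
      · simpa [w] using hyv.1 hvF.2
      · exact hyv.2 hvF.2
    · rw [if_neg hn] at hvF
      rw [(Nat.not_even_iff_odd.1 hn).add_one.neg_one_pow, one_smul]
      cases b
      · exact hyv.2 hvF.2
      · exact hyv.1 hvF.2
  refine ⟨w, hsub _ (by simpa using hgF 0), Fin.snoc g J, ?_, fun i ↦ ?_⟩
  · rw [Fin.strictMono_iff_lt_succ]
    intro i
    induction i using Fin.lastCases with
    | last => simpa using hJ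
    | cast i =>
      rw [← Fin.castSucc_succ, Fin.snoc_castSucc, Fin.snoc_castSucc]
      exact hg i.castSucc_lt_succ
  · induction i using Fin.lastCases with
    | last => simpa using hJF
    | cast i => simpa using hgF i
end

section
/- Let F be a finite closed antipodal-free cover of S^n. Then F has at least n+2 members. -/
namespace LusternikSchnirelmann

/-- Ordered simplicial chains mod 2: formal sums of finite vertex lists. -/
abbrev Chain (X : Type*) := List X →₀ ZMod 2

section Chains

variable {X : Type*}

lemma chain_add_self (c : Chain X) : c + c = 0 := by
  ext w
  exact CharTwo.add_self_eq_zero _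

/-- Prepend a vertex to every simplex of a chain. -/
noncomputable def cons (x : X) : Chain X →ₗ[ZMod 2] Chain X :=
  Finsupp.lmapDomain _ _ (fun w => x :: w)

/-- The chain map induced by a map of vertices. -/
noncomputable def push (f : X → X) : Chain X →ₗ[ZMod 2] Chain X :=
  Finsupp.lmapDomain _ _ (List.map f)

/-- The boundary of a simplex. -/
noncomputable def bdryList : List X → Chain X
  | [] => 0
  | x :: w => Finsupp.single w 1 + cons x (bdryList w)

/-- The (augmented) boundary operator. -/
noncomputable def bdry : Chain X →ₗ[ZMod 2] Chain X :=
  Finsupp.linearCombination _ bdryList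

/-- The prism over a simplex, from its image under `f` to its image under `g`. -/
noncomputable def prismList (f g : X → X) : List X → Chain X
  | [] => 0
  | x :: w => Finsupp.single (f x :: g x :: w.map g) 1 + cons (f x) (prismList f g w)

/-- The prism operator between two vertex maps. -/
noncomputable def prism (f g : X → X) : Chain X →ₗ[ZMod 2] Chain X :=
  Finsupp.linearCombination _ (prismList f g)

@[simp] lemma cons_single (x : X) (w : List X) (r : ZMod 2) :
    cons x (Finsupp.single w r) = Finsupp.single (x :: w) r := by
  simp [cons]

@[simp] lemma push_single (f : X → X) (w : List X) (r : ZMod 2) :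
    push f (Finsupp.single w r) = Finsupp.single (w.map f) r := by
  simp [push]

@[simp] lemma bdry_single (w : List X) : bdry (Finsupp.single w 1) = bdryList w := by
  simp [bdry]

@[simp] lemma prism_single (f g : X → X) (w : List X) :
    prism f g (Finsupp.single w 1) = prismList f g w := by
  simp [prism]

lemma linearMap_ext {M : Type*} [AddCommMonoid M] [Module (ZMod 2) M]
    {L L' : Chain X →ₗ[ZMod 2] M}
    (h : ∀ w, L (Finsupp.single w 1) = L' (Finsupp.single w 1)) : L = L' :=
  Finsupp.lhom_ext' fun w => LinearMap.ext_ring (h w)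

lemma linearMap_eq_of_mem_supported {M : Type*} [AddCommMonoid M] [Module (ZMod 2) M]
    {L L' : Chain X →ₗ[ZMod 2] M} {s : Set (List X)}
    (h : ∀ w ∈ s, L (Finsupp.single w 1) = L' (Finsupp.single w 1))
    {c : Chain X} (hc : c ∈ Finsupp.supported (ZMod 2) (ZMod 2) s) : L c = L' c := by
  rw [Finsupp.supported_eq_span_single] at hc
  refine LinearMap.eqOn_span ?_ hc
  rintro _ ⟨w, hw, rfl⟩
  exact h w hw

lemma bdry_cons (x : X) (c : Chain X) : bdry (cons x c) = c + cons x (bdry c) := by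
  have : bdry ∘ₗ cons x = LinearMap.id + cons x ∘ₗ bdry :=
    linearMap_ext fun w => by simp [bdryList]
  exact LinearMap.congr_fun this c

lemma push_cons (f : X → X) (x : X) (c : Chain X) :
    push f (cons x c) = cons (f x) (push f c) := by
  have : push f ∘ₗ cons x = cons (f x) ∘ₗ push f :=
    linearMap_ext fun w => by simp
  exact LinearMap.congr_fun this c

lemma push_push (f g : X → X) (c : Chain X) : push f (push g c) = push (f ∘ g) c := by
  have : push f ∘ₗ push g = push (f ∘ g) := linearMap_ext fun w => by simp
  exact LinearMap.congr_fun this c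

lemma push_id (c : Chain X) : push id c = c := by
  have : push (id : X → X) = LinearMap.id := linearMap_ext fun w => by simp
  exact LinearMap.congr_fun this c

lemma prism_cons (f g : X → X) (x : X) (c : Chain X) :
    prism f g (cons x c) = cons (f x) (cons (g x) (push g c)) + cons (f x) (prism f g c) := by
  have : prism f g ∘ₗ cons x =
      cons (f x) ∘ₗ cons (g x) ∘ₗ push g + cons (f x) ∘ₗ prism f g :=
    linearMap_ext fun w => by simp [prismList]
  exact LinearMap.congr_fun this c

lemma bdry_push (f : X → X) (c : Chain X) : bdry (push f c) = push f (bdry c) := by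
  have : bdry ∘ₗ push f = push f ∘ₗ bdry := linearMap_ext fun w => by
    simp only [LinearMap.comp_apply, push_single, bdry_single]
    induction w with
    | nil => simp [bdryList]
    | cons x w ih => simp [bdryList, ih, push_cons]
  exact LinearMap.congr_fun this c

lemma bdry_bdryList (w : List X) : bdry (bdryList w) = 0 := by
  induction w with
  | nil => simp [bdryList]
  | cons x w ih => simp [bdryList, bdry_cons, ih, chain_add_self]

lemma bdry_prism (f g : X → X) (c : Chain X) :
    bdry (prism f g c) + prism f g (bdry c) = push f c + push g c := by
  have : bdry ∘ₗ prism f g + prism f g ∘ₗ bdry = push f + push g := linearMap_ext fun w => by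
    simp only [LinearMap.comp_apply, LinearMap.add_apply, push_single, bdry_single, prism_single]
    induction w with
    | nil => simp [bdryList, prismList, chain_add_self]
    | cons x w ih =>
      have h1 : bdryList (w.map g) = push g (bdryList w) := by
        rw [← bdry_single, ← bdry_single, ← bdry_push, push_single]
      have h2 := congrArg (cons (f x)) ih
      simp only [map_add, cons_single] at h2
      have e1 := chain_add_self (prismList f g w)
      have e2 := chain_add_self (cons (f x) (cons (g x) (push g (bdryList w))))
      have e3 := chain_add_self (Finsupp.single (f x :: w.map g) (1 : ZMod 2))
      simp only [bdryList, prismList, map_add, bdry_single, bdry_cons, prism_single, prism_cons,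
        cons_single, h1, List.map_cons]
      linear_combination (norm := module) h2 + e1 + e2 + e3
  exact LinearMap.congr_fun this c

lemma linearCombination_mem {M : Type*} [AddCommMonoid M] [Module (ZMod 2) M]
    {N : Submodule (ZMod 2) M} {s : Set (List X)} {φ : List X → M} (hφ : ∀ w ∈ s, φ w ∈ N)
    {c : Chain X} (hc : c ∈ Finsupp.supported (ZMod 2) (ZMod 2) s) :
    Finsupp.linearCombination (ZMod 2) φ c ∈ N := by
  rw [Finsupp.linearCombination_apply]
  exact N.sum_mem fun w hw => N.smul_mem _ (hφ w (hc hw))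

lemma push_mem_supported {f : X → X} {s t : Set (List X)} (hf : ∀ w ∈ s, w.map f ∈ t)
    {c : Chain X} (hc : c ∈ Finsupp.supported (ZMod 2) (ZMod 2) s) :
    push f c ∈ Finsupp.supported (ZMod 2) (ZMod 2) t := by
  classical
  intro u hu
  obtain ⟨w, hw, rfl⟩ := Finset.mem_image.1 (Finsupp.mapDomain_support hu)
  exact hf w (hc hw)

lemma prismList_mem_supported (f g : X → X) (w : List X) :
    prismList f g w ∈ Finsupp.supported (ZMod 2) (ZMod 2)
      {u | u.length = w.length + 1 ∧ ∀ v ∈ u, ∃ x ∈ w, v = f x ∨ v = g x} := by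
  induction w with
  | nil => simp [prismList]
  | cons x w ih =>
    refine Submodule.add_mem _ (Finsupp.single_mem_supported _ _ ?_) ?_
    · simp
      grind
    · classical
      intro u hu
      obtain ⟨u', hu', rfl⟩ := Finset.mem_image.1 (Finsupp.mapDomain_support hu)
      have := ih hu'
      simp only [Set.mem_ofPred_eq] at this ⊢
      simp
      grind

/-- The prisms over consecutive members of a sequence of vertex maps, added up. -/
noncomputable def homotopyChain (f : ℕ → X → X) (N : ℕ) (c : Chain X) : Chain X :=
  ∑ i ∈ Finset.range N, prism (f i) (f (i + 1)) c

lemma bdry_homotopyChain (f : ℕ → X → X) (N : ℕ) {c : Chain X} (hc : bdry c = 0) :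
    bdry (homotopyChain f N c) = push (f 0) c + push (f N) c := by
  induction N with
  | zero => simp [homotopyChain, chain_add_self]
  | succ N ih =>
    have h := bdry_prism (f N) (f (N + 1)) c
    rw [homotopyChain, Finset.sum_range_succ, map_add]
    rw [homotopyChain] at ih
    rw [ih]
    simp only [hc, map_zero, add_zero] at h
    rw [h]
    linear_combination (norm := module) chain_add_self (push (f N) c)

end Chains

section Cochains

variable {X : Type*} (g : ℕ → X → ZMod 2)

/-- The cup product of the coboundaries of `g (k - 1), …, g 0`, evaluated on a simplex. -/
def cocycle : ℕ → List X → ZMod 2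
  | 0, _ => 1
  | k + 1, v :: v' :: t => (g k v + g k v') * cocycle k (v' :: t)
  | _ + 1, _ => 0

/-- The cup product of `g k` with `cocycle g k`. -/
def cochain (k : ℕ) : List X → ZMod 2
  | [] => 0
  | v :: t => g k v * cocycle g k (v :: t)

/-- Evaluation of a cochain on a chain. -/
noncomputable def eval (a : List X → ZMod 2) : Chain X →ₗ[ZMod 2] ZMod 2 :=
  Finsupp.linearCombination _ a

@[simp] lemma eval_single (a : List X → ZMod 2) (w : List X) :
    eval a (Finsupp.single w 1) = a w := by
  simp [eval]

lemma eval_cochain_cons (k : ℕ) (v : X) (c : Chain X) :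
    eval (cochain g k) (cons v c) = g k v * eval (cocycle g k) (cons v c) := by
  have : eval (cochain g k) ∘ₗ cons v = g k v • (eval (cocycle g k) ∘ₗ cons v) :=
    linearMap_ext fun w => by simp [cochain]
  exact LinearMap.congr_fun this c

lemma eval_bdryList (k : ℕ) : ∀ w : List X, w.length = k + 2 →
    eval (cocycle g k) (bdryList w) = 0 ∧
      eval (cochain g k) (bdryList w) = cocycle g (k + 1) w := by
  have key : ∀ k, (∀ w : List X, w.length = k + 2 → eval (cocycle g k) (bdryList w) = 0) →
      ∀ w : List X, w.length = k + 2 →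
        eval (cochain g k) (bdryList w) = cocycle g (k + 1) w := by
    intro k h w hw
    obtain ⟨v, v', t, rfl⟩ : ∃ v v' t, w = v :: v' :: t := by
      match w, hw with
      | v :: v' :: t, _ => exact ⟨v, v', t, rfl⟩
    have h0 := h _ hw
    rw [bdryList, map_add, eval_single] at h0
    rw [bdryList, map_add, eval_single]
    rw [eval_cochain_cons, cocycle, cochain]
    have h1 := CharTwo.add_self_eq_zero (cocycle g k (v' :: t))
    linear_combination g k v * h0 - g k v * h1
  have main : ∀ k, ∀ w : List X, w.length = k + 2 → eval (cocycle g k) (bdryList w) = 0 := by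
    intro k
    induction k with
    | zero =>
      intro w hw
      match w, hw with
      | [v, v'], _ => simp [bdryList, cocycle, CharTwo.add_self_eq_zero]
    | succ k ih =>
      intro w hw
      have hs : ∀ w : List X, bdryList w ∈ Finsupp.supported (ZMod 2) (ZMod 2)
          {u : List X | u.length + 1 = w.length} := by
        intro w
        induction w with
        | nil => simp [bdryList]
        | cons x w ih =>
          refine Submodule.add_mem _ (Finsupp.single_mem_supported _ _ (by simp)) ?_
          classical
          intro u hu
          obtain ⟨u', hu', rfl⟩ := Finset.mem_image.1 (Finsupp.mapDomain_support hu)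
          have := ih hu'
          simp only [Set.mem_ofPred_eq] at this ⊢
          simp [this]
      have h1 : eval (cochain g k) (bdry (bdryList w)) = eval (cocycle g (k + 1)) (bdryList w) := by
        refine linearMap_eq_of_mem_supported (L := eval (cochain g k) ∘ₗ bdry)
          (fun u hu => ?_) (hs w)
        simp only [Set.mem_ofPred_eq] at hu
        simp [key k ih u (by omega)]
      rw [← h1, bdry_bdryList, map_zero]
  exact fun w hw => ⟨main k w hw, key k (main k) w hw⟩

lemma eval_cochain_bdry {k : ℕ} {c : Chain X}
    (hc : c ∈ Finsupp.supported (ZMod 2) (ZMod 2) {w | w.length = k + 2}) :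
    eval (cochain g k) (bdry c) = eval (cocycle g (k + 1)) c := by
  refine linearMap_eq_of_mem_supported (L := eval (cochain g k) ∘ₗ bdry) (fun u hu => ?_) hc
  simp [(eval_bdryList g k u hu).2]

variable {g}

lemma exists_ne_of_cocycle_ne_zero {k : ℕ} {w : List X} (h : cocycle g k w ≠ 0) {i : ℕ}
    (hi : i < k) : ∃ u ∈ w, ∃ v ∈ w, g i u ≠ g i v := by
  induction k generalizing w with
  | zero => omega
  | succ k ih =>
    match w, h with
    | [], h => exact absurd rfl h
    | [v], h => exact absurd rfl h
    | v :: v' :: t, h =>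
      rw [cocycle] at h
      rcases Nat.lt_succ_iff_lt_or_eq.1 hi with hi | rfl
      · obtain ⟨u, hu, u', hu', hne⟩ := ih (right_ne_zero_of_mul h) hi
        exact ⟨u, List.mem_cons_of_mem _ hu, u', List.mem_cons_of_mem _ hu', hne⟩
      · refine ⟨v, by simp, v', by simp, fun he => left_ne_zero_of_mul h ?_⟩
        rw [he, CharTwo.add_self_eq_zero]

end Cochains
section Antipodal

variable {X : Type*} [Neg X] {g : ℕ → X → ZMod 2}

lemma cocycle_map_neg (k : ℕ) (w : List X) (hg : ∀ v ∈ w, ∀ i, g i (-v) = g i v + 1) :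
    cocycle g k (w.map Neg.neg) = cocycle g k w := by
  induction k generalizing w with
  | zero => simp [cocycle]
  | succ k ih =>
    match w, hg with
    | [], _ => rfl
    | [v], _ => rfl
    | v :: v' :: t, hg =>
      have h := ih (v' :: t) fun u hu => hg u (List.mem_cons_of_mem _ hu)
      simp only [List.map_cons] at h ⊢
      rw [cocycle, cocycle, h, hg v (by simp), hg v' (by simp)]
      linear_combination cocycle g k (v' :: t) * CharTwo.add_self_eq_zero (1 : ZMod 2)

lemma cochain_add_cochain_map_neg (k : ℕ) (w : List X) (hw : w ≠ [])
    (hg : ∀ v ∈ w, ∀ i, g i (-v) = g i v + 1) :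
    cochain g k w + cochain g k (w.map Neg.neg) = cocycle g k w := by
  match w, hw, hg with
  | v :: t, _, hg =>
    have h := cocycle_map_neg k (v :: t) hg
    simp only [List.map_cons] at h ⊢
    rw [cochain, cochain, h, hg v (by simp)]
    linear_combination CharTwo.add_self_eq_zero (g k v * cocycle g k (v :: t))

lemma eval_cochain_add_push_neg (k : ℕ) {s : Set (List X)}
    (hs : ∀ w ∈ s, w ≠ [] ∧ ∀ v ∈ w, ∀ i, g i (-v) = g i v + 1)
    {c : Chain X} (hc : c ∈ Finsupp.supported (ZMod 2) (ZMod 2) s) :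
    eval (cochain g k) (c + push Neg.neg c) = eval (cocycle g k) c := by
  refine linearMap_eq_of_mem_supported
    (L := eval (cochain g k) ∘ₗ (LinearMap.id + push Neg.neg)) (fun w hw => ?_) hc
  simpa using cochain_add_cochain_map_neg k w (hs w hw).1 (hs w hw).2

end Antipodal

section Sphere

variable {n : ℕ}

/-- The simplices of dimension `k` and diameter less than `ε` with vertices in the unit sphere of
the span of the first `k + 1` coordinate vectors. -/
def smallSimplices (n k : ℕ) (ε : ℝ) : Set (List (EuclideanSpace ℝ (Fin (n + 1)))) :=
  {w | w.length = k + 1 ∧ (∀ v ∈ w, ‖v‖ = 1 ∧ ∀ j : Fin (n + 1), k < j → v j = 0) ∧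
    ∀ u ∈ w, ∀ v ∈ w, dist u v < ε}

lemma push_neg_mem_smallSimplices {k : ℕ} {ε : ℝ} {c : Chain (EuclideanSpace ℝ (Fin (n + 1)))}
    (hc : c ∈ Finsupp.supported (ZMod 2) (ZMod 2) (smallSimplices n k ε)) :
    push Neg.neg c ∈ Finsupp.supported (ZMod 2) (ZMod 2) (smallSimplices n k ε) := by
  refine push_mem_supported (fun w hw => ?_) hc
  obtain ⟨h1, h2, h3⟩ := hw
  refine ⟨by simpa using h1, ?_, ?_⟩
  · simp only [List.mem_map, forall_exists_index, and_imp, forall_apply_eq_imp_iff₂, norm_neg]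
    intro v hv
    exact ⟨(h2 v hv).1, fun j hj => by simp [(h2 v hv).2 j hj]⟩
  · simp only [List.mem_map, forall_exists_index, and_imp, forall_apply_eq_imp_iff₂, dist_neg_neg]
    exact h3

/-- The point at angle `t` on the arc from `x` to `p`. -/
noncomputable def arc {E : Type*} [AddCommGroup E] [Module ℝ E] (p : E) (t : ℝ) (x : E) : E :=
  Real.cos t • x + Real.sin t • p

lemma norm_arc {E : Type*} [NormedAddCommGroup E] [InnerProductSpace ℝ E] {p x : E}
    (hp : ‖p‖ = 1) (hx : ‖x‖ = 1) (h : inner ℝ x p = 0) (t : ℝ) : ‖arc p t x‖ = 1 := by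
  have : ‖arc p t x‖ ^ 2 = 1 := by
    rw [arc, norm_add_sq_real, norm_smul, norm_smul, hp, hx, inner_smul_left, inner_smul_right, h]
    simp
  nlinarith [norm_nonneg (arc p t x)]

lemma dist_arc_le {E : Type*} [NormedAddCommGroup E] [InnerProductSpace ℝ E] {p x y : E}
    (hp : ‖p‖ = 1) (hy : ‖y‖ = 1) (s t : ℝ) :
    dist (arc p s x) (arc p t y) ≤ dist x y + 2 * |s - t| := by
  have : arc p s x - arc p t y = Real.cos s • (x - y) + (Real.cos s - Real.cos t) • y +
      (Real.sin s - Real.sin t) • p := by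
    simp only [arc]
    module
  rw [dist_eq_norm, dist_eq_norm, this]
  refine (norm_add₃_le).trans ?_
  rw [norm_smul, norm_smul, norm_smul, hp, hy, Real.norm_eq_abs, Real.norm_eq_abs,
    Real.norm_eq_abs]
  have h1 := Real.abs_cos_sub_cos_le s t
  have h2 := Real.abs_sin_sub_sin_le s t
  have h3 := mul_le_of_le_one_left (norm_nonneg (x - y)) (Real.abs_cos_le_one s)
  linarith

/-- A cycle of the form `h + (-h)` in the `k`-sphere bounds a chain of small simplices in the
`(k + 1)`-sphere. -/
lemma exists_bdry_eq {k : ℕ} (hk : k + 1 ≤ n) {ε : ℝ} (hε : 0 < ε)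
    {h : Chain (EuclideanSpace ℝ (Fin (n + 1)))}
    (hh : h ∈ Finsupp.supported (ZMod 2) (ZMod 2) (smallSimplices n k (ε / 2)))
    (hz : bdry (h + push Neg.neg h) = 0) :
    ∃ h' ∈ Finsupp.supported (ZMod 2) (ZMod 2) (smallSimplices n (k + 1) ε),
      bdry h' = h + push Neg.neg h := by
  set p : EuclideanSpace ℝ (Fin (n + 1)) := EuclideanSpace.single ⟨k + 1, by omega⟩ 1 with hp
  have hp1 : ‖p‖ = 1 := by simp [hp]
  obtain ⟨N, hN⟩ := exists_nat_gt (2 * Real.pi / ε)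
  have hN0 : (0 : ℝ) < N := lt_trans (by positivity) hN
  let θ : ℕ → ℝ := fun i => i * (Real.pi / 2 / N)
  have hθ : ∀ i j : ℕ, (i = j ∨ i = j + 1 ∨ j = i + 1) → 2 * |θ i - θ j| < ε / 2 := by
    intro i j hij
    have h1 : |(i : ℝ) - j| ≤ 1 := by
      rcases hij with rfl | rfl | rfl <;> simp
    have h2 : |θ i - θ j| ≤ Real.pi / 2 / N := by
      rw [← sub_mul, abs_mul, abs_of_pos (a := Real.pi / 2 / N) (by positivity)]
      exact mul_le_of_le_one_left (by positivity) h1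
    have h3 : 2 * (Real.pi / 2 / N) < ε / 2 := by
      rw [div_lt_iff₀ hε] at hN
      rw [← mul_div_assoc, div_lt_iff₀ hN0]
      linarith
    linarith
  let f : ℕ → EuclideanSpace ℝ (Fin (n + 1)) → EuclideanSpace ℝ (Fin (n + 1)) :=
    fun i => arc p (θ i)
  refine ⟨homotopyChain f N (h + push Neg.neg h), ?_, ?_⟩
  · refine Submodule.sum_mem _ fun i _ => linearCombination_mem (fun w hw => ?_)
      (Submodule.add_mem _ hh (push_neg_mem_smallSimplices hh))
    obtain ⟨hw1, hw2, hw3⟩ := hw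
    refine Finsupp.supported_mono ?_ (prismList_mem_supported (f i) (f (i + 1)) w)
    rintro u ⟨hu1, hu2⟩
    have hu2' : ∀ v ∈ u, ∃ x ∈ w, ∃ j, (j = i ∨ j = i + 1) ∧ v = arc p (θ j) x := by
      intro v hv
      obtain ⟨x, hx, rfl | rfl⟩ := hu2 v hv
      exacts [⟨x, hx, i, by simp, rfl⟩, ⟨x, hx, i + 1, by simp, rfl⟩]
    refine ⟨by omega, fun v hv => ?_, fun v hv v' hv' => ?_⟩
    · obtain ⟨x, hx, j, -, rfl⟩ := hu2' v hv
      refine ⟨norm_arc hp1 (hw2 x hx).1 ?_ _, fun l hl => ?_⟩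
      · rw [hp, EuclideanSpace.inner_single_right, (hw2 x hx).2 _ (by simp)]
        simp
      · have hne : l ≠ ⟨k + 1, by omega⟩ := by
          intro he
          simp [he] at hl
        simp [arc, hp, (hw2 x hx).2 l (by omega), hne]
    · obtain ⟨x, hx, j, hj, rfl⟩ := hu2' v hv
      obtain ⟨x', hx', j', hj', rfl⟩ := hu2' v' hv'
      have h1 := dist_arc_le (x := x) hp1 (hw2 x' hx').1 (θ j) (θ j')
      have h2 := hw3 x hx x' hx'
      have h3 := hθ j j' (by omega)
      linarith
  · have hf0 : f 0 = id := by
      funext x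
      simp [f, θ, arc]
    have hfN : f N = fun _ => p := by
      funext x
      have : θ N = Real.pi / 2 := by
        simp only [θ]
        field_simp
      simp [f, arc, this]
    have hc : push (fun _ => p) (push Neg.neg h) = push (fun _ => p) h := by
      rw [push_push]
      rfl
    rw [bdry_homotopyChain f N hz, hf0, hfN, push_id, map_add (push fun _ => p), hc,
      chain_add_self, add_zero]

lemma exists_smallSimplices_cycle {g : ℕ → EuclideanSpace ℝ (Fin (n + 1)) → ZMod 2}
    (hg : ∀ i v, v ≠ 0 → g i (-v) = g i v + 1) {k : ℕ} (hk : k ≤ n) {ε : ℝ} (hε : 0 < ε) :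
    ∃ h ∈ Finsupp.supported (ZMod 2) (ZMod 2) (smallSimplices n k ε),
      bdry (h + push Neg.neg h) = 0 ∧ eval (cochain g k) (h + push Neg.neg h) = 1 := by
  induction k generalizing ε with
  | zero =>
    set p : EuclideanSpace ℝ (Fin (n + 1)) := EuclideanSpace.single 0 1 with hp
    have hp0 : p ≠ 0 := by simp [hp]
    refine ⟨Finsupp.single [p] 1, Finsupp.single_mem_supported _ _ ⟨rfl, ?_, ?_⟩, ?_, ?_⟩
    · intro v hv
      obtain rfl := List.mem_singleton.1 hv
      refine ⟨by simp [hp], fun j hj => ?_⟩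
      have : j ≠ 0 := by
        rintro rfl
        simp at hj
      simp [hp, this]
    · simpa using hε
    · simp [bdryList, chain_add_self]
    · simp only [push_single, map_add, eval_single, List.map_cons, List.map_nil, cochain, cocycle,
        mul_one, hg 0 p hp0]
      linear_combination CharTwo.add_self_eq_zero (g 0 p)
  | succ k ih =>
    obtain ⟨h, hh, hz, he⟩ := ih (by omega) (half_pos hε)
    obtain ⟨h', hh', hb⟩ := exists_bdry_eq hk hε hh hz
    refine ⟨h', hh', ?_, ?_⟩
    · rw [map_add, bdry_push, hb, map_add, push_push]
      have : (Neg.neg ∘ Neg.neg : EuclideanSpace ℝ (Fin (n + 1)) → _) = id := by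
        funext x
        simp
      rw [this, push_id, add_comm (push Neg.neg h), chain_add_self]
    · rw [eval_cochain_add_push_neg (k + 1) (fun w hw => ⟨?_, ?_⟩) hh',
        ← eval_cochain_bdry, hb, he]
      · exact Finsupp.supported_mono (fun w hw => hw.1) hh'
      · rintro rfl
        exact absurd hw.1 (by simp)
      · intro v hv i
        refine hg i v ?_
        rintro rfl
        simpa using (hw.2.1 0 hv).1

lemma exists_antipodal_sign {E : Type*} [AddCommGroup E] [Module ℝ E] {U : Set E}
    (hU : Disjoint U (-U)) :
    ∃ g : E → ZMod 2, (∀ v ∈ U, g v = 1) ∧ ∀ v ≠ 0, g (-v) = g v + 1 := by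
  classical
  refine ⟨fun v => if v ∈ U then 1 else if -v ∈ U then 0 else
    if WellOrderingRel v (-v) then 1 else 0, fun v hv => by simp [hv], fun v hv => ?_⟩
  have hd : v ∈ U → -v ∉ U := fun h h' => Set.disjoint_left.1 hU h h'
  have hne : v ≠ -v := by
    intro h
    have h' : (2 : ℝ) • v = 0 := by
      rw [two_smul]
      nth_rewrite 2 [h]
      exact add_neg_cancel v
    exact hv ((smul_eq_zero.1 h').resolve_left two_ne_zero)
  have h2 : (1 : ZMod 2) + 1 = 0 := CharTwo.add_self_eq_zero 1
  by_cases h1 : v ∈ U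
  · simp [h1, hd h1, h2]
  by_cases h3 : -v ∈ U
  · simp [h1, h3]
  rcases trichotomous_of WellOrderingRel v (-v) with h | h | h
  · simp [h1, h3, h, asymm_of WellOrderingRel h, h2]
  · exact absurd h hne
  · simp [h1, h3, h, asymm_of WellOrderingRel h]

lemma not_sphere_subset_iUnion {G : ℕ → Set (EuclideanSpace ℝ (Fin (n + 1)))}
    (hclosed : ∀ i, IsClosed (G i)) (hsub : ∀ i, G i ⊆ Metric.sphere 0 1)
    (hanti : ∀ i, Disjoint (G i) (-G i)) :
    ¬ ∀ v ∈ Metric.sphere (0 : EuclideanSpace ℝ (Fin (n + 1))) 1, ∃ i ≤ n, v ∈ G i := by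
  intro hcover
  have hcompact : ∀ i, IsCompact (G i) := fun i =>
    (isCompact_sphere 0 1).of_isClosed_subset (hclosed i) (hsub i)
  choose δ hδ hdis using fun i => (hanti i).exists_thickenings (hcompact i) (hclosed i).neg
  have hneg : ∀ i, -Metric.thickening (δ i) (G i) ⊆ Metric.thickening (δ i) (-G i) := by
    intro i v hv
    obtain ⟨x, hx, hd⟩ := Metric.mem_thickening_iff.1 (Set.mem_neg.1 hv)
    exact Metric.mem_thickening_iff.2 ⟨-x, by simpa using hx, by rwa [← dist_neg_neg, neg_neg]⟩
  choose g hg1 hg2 using fun i => exists_antipodal_sign ((hdis i).mono_right (hneg i))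
  obtain ⟨ε, hε, hεδ⟩ : ∃ ε > 0, ∀ i ∈ Finset.range n, ε ≤ δ i := by
    have h1 : ∀ᶠ ε in nhdsWithin (0 : ℝ) (Set.Ioi 0), ∀ i ∈ Finset.range n, ε ≤ δ i :=
      (Filter.eventually_all_finset _).2 fun i _ =>
        nhdsWithin_le_nhds (Iic_mem_nhds (hδ i))
    exact (eventually_mem_nhdsWithin.and h1).exists
  obtain ⟨h, hh, -, he⟩ := exists_smallSimplices_cycle (g := g) hg2 le_rfl hε
  have hs := Submodule.add_mem _ hh (push_neg_mem_smallSimplices hh)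
  obtain ⟨w, hw, hne⟩ : ∃ w ∈ smallSimplices n n ε, cochain g n w ≠ 0 := by
    by_contra! hcon
    have := linearMap_eq_of_mem_supported (L := eval (cochain g n)) (L' := 0)
      (fun w hw => by simpa using hcon w hw) hs
    simp [he] at this
  obtain ⟨-, hw1, hw2⟩ := hw
  obtain ⟨v, t, rfl⟩ : ∃ v t, w = v :: t :=
    List.exists_cons_of_ne_nil (by rintro rfl; exact hne rfl)
  rw [cochain] at hne
  have hv : v ∈ v :: t := by simp
  have key : ∀ i < n, v ∉ G i ∧ -v ∉ G i := by
    intro i hi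
    have hεi := hεδ i (Finset.mem_range.2 hi)
    obtain ⟨a, ha, b, hb, hab⟩ := exists_ne_of_cocycle_ne_zero (right_ne_zero_of_mul hne) hi
    have hne0 : ∀ u ∈ v :: t, u ≠ 0 := by
      rintro u hu rfl
      simpa using (hw1 0 hu).1
    refine ⟨fun hG => hab ?_, fun hG => hab ?_⟩
    · have : ∀ u ∈ v :: t, g i u = 1 := fun u hu => hg1 i u
        (Metric.mem_thickening_iff.2 ⟨v, hG, (hw2 u hu v hv).trans_le hεi⟩)
      rw [this a ha, this b hb]
    · have : ∀ u ∈ v :: t, g i (-u) = 1 := fun u hu => hg1 i (-u)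
        (Metric.mem_thickening_iff.2 ⟨-v, hG, by
          rw [dist_neg_neg]
          exact (hw2 u hu v hv).trans_le hεi⟩)
      have hab' := (this a ha).trans (this b hb).symm
      rw [hg2 i a (hne0 a ha), hg2 i b (hne0 b hb)] at hab'
      exact add_right_cancel hab'
  have hlast : ∀ u ∈ Metric.sphere (0 : EuclideanSpace ℝ (Fin (n + 1))) 1,
      (∀ i < n, u ∉ G i) → u ∈ G n := by
    intro u hu hi
    obtain ⟨i, hin, hui⟩ := hcover u hu
    rcases hin.lt_or_eq with hlt | rfl
    exacts [absurd hui (hi i hlt), hui]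
  have hv1 := (hw1 v hv).1
  exact Set.disjoint_left.1 (hanti n) (hlast v (by simpa using hv1) fun i hi => (key i hi).1)
    (hlast (-v) (by simpa using hv1) fun i hi => (key i hi).2)

end Sphere

end LusternikSchnirelmann


/-- Lusternik–Schnirelmann: a finite closed antipodal-free cover of `S^n`
has at least `n + 2` members. -/
theorem lusternik_schnirelmann {n : ℕ} {ι : Type*} [Fintype ι]
    (F : ι → Set (EuclideanSpace ℝ (Fin (n + 1))))
    (hclosed : ∀ i, IsClosed (F i))
    (hsub : ∀ i, F i ⊆ Metric.sphere (0 : EuclideanSpace ℝ (Fin (n + 1))) 1)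
    (hcover : Metric.sphere (0 : EuclideanSpace ℝ (Fin (n + 1))) 1 ⊆ ⋃ i, F i)
    (hanti : ∀ i, F i ∩ (-F i) = ∅) :
    n + 2 ≤ Fintype.card ι := by
  by_contra! hcard
  let e := Fintype.equivFin ι
  let G : ℕ → Set (EuclideanSpace ℝ (Fin (n + 1))) := fun k =>
    if h : k < Fintype.card ι then F (e.symm ⟨k, h⟩) else ∅
  have hG : ∀ k, (∃ i, G k = F i) ∨ G k = ∅ := by
    intro k
    by_cases h : k < Fintype.card ι
    · exact Or.inl ⟨_, dif_pos h⟩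
    · exact Or.inr (dif_neg h)
  refine LusternikSchnirelmann.not_sphere_subset_iUnion (G := G) ?_ ?_ ?_ ?_
  · intro k
    obtain ⟨i, h⟩ | h := hG k <;> simp [h, hclosed]
  · intro k
    obtain ⟨i, h⟩ | h := hG k <;> simp only [h, hsub, Set.empty_subset]
  · intro k
    obtain ⟨i, h⟩ | h := hG k
    · rw [h]
      exact Set.disjoint_iff_inter_eq_empty.2 (hanti i)
    · simp [h]
  · intro v hv
    obtain ⟨i, hi⟩ := Set.mem_iUnion.1 (hcover hv)
    refine ⟨e i, by have := (e i).2; omega, ?_⟩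
    simpa [G] using hi
end

section
/- Let F be a finite closed antipodal-free cover of S^n equipped with two linear orders ≤₁ and ≤₂. Then there exists u ∈ S^n, a sign ε ∈ {±1}, and sets F₁, ..., F_m ∈ F with m ≥ ((n+1)/2)^{1/2}, such that u ∈ ε(-1)^{i-1}F_i for all i, and the sequence F₁, ..., F_m is monotone with respect to ≤₁ (either increasing or decreasing) and monotone with respect to ≤₂. -/
open Pointwise

namespace KyFan

section Chains

variable {V : Type*}

/-- Augmented ordered simplicial chains with coefficients in `ZMod 2`; a simplex is the list of
its vertices. -/
abbrev Chain (V : Type*) := List V →₀ ZMod 2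

/-- The cone with apex `v` over a chain. -/
noncomputable def cone (v : V) : Chain V →ₗ[ZMod 2] Chain V :=
  Finsupp.lmapDomain _ _ (List.cons v)

/-- The boundary of a single simplex. -/
noncomputable def boundaryList : List V → Chain V
  | [] => 0
  | v :: l => Finsupp.single l 1 + cone v (boundaryList l)

/-- The boundary operator of the augmented chain complex. -/
noncomputable def boundary : Chain V →ₗ[ZMod 2] Chain V :=
  Finsupp.linearCombination (ZMod 2) boundaryList

@[simp] lemma cone_single (v : V) (l : List V) (a : ZMod 2) :
    cone v (Finsupp.single l a) = Finsupp.single (v :: l) a := by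
  simp [cone, Finsupp.lmapDomain_apply]

@[simp] lemma boundary_single (l : List V) :
    boundary (Finsupp.single l 1) = boundaryList l := by
  simp [boundary]

lemma boundary_cone (v : V) (c : Chain V) :
    boundary (cone v c) = c + cone v (boundary c) := by
  have : (boundary ∘ₗ cone v : Chain V →ₗ[ZMod 2] Chain V)
      = LinearMap.id + cone v ∘ₗ boundary := by
    ext1 l
    ext1
    simp [boundaryList]
  exact LinearMap.congr_fun this c

lemma boundary_boundaryList (l : List V) : boundary (boundaryList l) = 0 := by
  induction l with
  | nil => simp [boundaryList]
  | cons v l ih =>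
    simp [boundaryList, boundary_cone, ih, ZModModule.add_self]

/-- The chain map induced by a map on vertices. -/
noncomputable def mapChain {W : Type*} (f : V → W) : Chain V →ₗ[ZMod 2] Chain W :=
  Finsupp.lmapDomain _ _ (List.map f)

@[simp] lemma mapChain_single {W : Type*} (f : V → W) (l : List V) (a : ZMod 2) :
    mapChain f (Finsupp.single l a) = Finsupp.single (l.map f) a := by
  simp [mapChain, Finsupp.lmapDomain_apply]

lemma mapChain_cone {W : Type*} (f : V → W) (v : V) (c : Chain V) :
    mapChain f (cone v c) = cone (f v) (mapChain f c) := by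
  have : (mapChain f ∘ₗ cone v : Chain V →ₗ[ZMod 2] Chain W)
      = cone (f v) ∘ₗ mapChain f := by
    ext1 l
    ext1
    simp
  exact LinearMap.congr_fun this c

lemma mapChain_boundaryList {W : Type*} (f : V → W) (l : List V) :
    mapChain f (boundaryList l) = boundaryList (l.map f) := by
  induction l with
  | nil => simp [boundaryList]
  | cons v l ih => simp [boundaryList, mapChain_cone, ih]

/-- The chains all of whose simplices lie in `A`. -/
abbrev chainsIn (A : Set (List V)) : Submodule (ZMod 2) (Chain V) :=
  Finsupp.supported (ZMod 2) (ZMod 2) A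

lemma linearCombination_mem {M : Type*} [AddCommGroup M] [Module (ZMod 2) M]
    {f : List V → M} {A : Set (List V)} {p : Submodule (ZMod 2) M}
    (h : ∀ l ∈ A, f l ∈ p) {c : Chain V} (hc : c ∈ chainsIn A) :
    Finsupp.linearCombination (ZMod 2) f c ∈ p := by
  rw [Finsupp.linearCombination_apply]
  exact p.sum_mem fun l hl => p.smul_mem _ (h l (hc hl))

lemma map_mem_of_single {M : Type*} [AddCommGroup M] [Module (ZMod 2) M]
    {f : Chain V →ₗ[ZMod 2] M} {A : Set (List V)} {p : Submodule (ZMod 2) M}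
    (h : ∀ l ∈ A, f (Finsupp.single l 1) ∈ p) {c : Chain V} (hc : c ∈ chainsIn A) :
    f c ∈ p := by
  have : f = Finsupp.linearCombination (ZMod 2) fun l => f (Finsupp.single l 1) := by
    ext1 l
    ext1
    simp
  rw [this]
  exact linearCombination_mem h hc

lemma cone_mem {A B : Set (List V)} {v : V} (h : ∀ l ∈ A, v :: l ∈ B) {c : Chain V}
    (hc : c ∈ chainsIn A) : cone v c ∈ chainsIn B :=
  map_mem_of_single (fun l hl => by
    rw [cone_single]; exact Finsupp.single_mem_supported _ _ (h l hl)) hc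

lemma boundaryList_mem (l : List V) :
    boundaryList l ∈ chainsIn {l' | l'.length + 1 = l.length ∧ l' ⊆ l} := by
  induction l with
  | nil => simp [boundaryList]
  | cons v l ih =>
    refine Submodule.add_mem _ (Finsupp.single_mem_supported _ _ ?_) (cone_mem ?_ ih)
    · simp
    · rintro l' ⟨h1, h2⟩
      exact ⟨by simp [h1], List.cons_subset_cons v h2⟩

lemma eqOn_chainsIn {M : Type*} [AddCommGroup M] [Module (ZMod 2) M]
    {f g : Chain V →ₗ[ZMod 2] M} {A : Set (List V)}
    (h : ∀ l ∈ A, f (Finsupp.single l 1) = g (Finsupp.single l 1)) {c : Chain V}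
    (hc : c ∈ chainsIn A) : f c = g c := by
  have := map_mem_of_single (f := f - g) (p := ⊥) (A := A)
    (fun l hl => by simp [h l hl]) hc
  simpa [sub_eq_zero] using this

end Chains

section Cochains

variable {V : Type*}

/-- The cup product of the coboundaries of `s j, s (j + 1), …`, evaluated on a simplex. -/
def cupList (s : ℕ → V → ZMod 2) : ℕ → List V → ZMod 2
  | _, [] => 1
  | _, [_] => 1
  | j, v :: w :: l => (s j v + s j w) * cupList s (j + 1) (w :: l)

/-- The cup product of `s j` with the coboundaries of `s (j + 1), s (j + 2), …`. -/
def headCupList (s : ℕ → V → ZMod 2) (j : ℕ) : List V → ZMod 2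
  | [] => 0
  | v :: l => s j v * cupList s (j + 1) (v :: l)

/-- `cupList` as a functional on chains. -/
noncomputable def cup (s : ℕ → V → ZMod 2) (j : ℕ) : Chain V →ₗ[ZMod 2] ZMod 2 :=
  Finsupp.linearCombination (ZMod 2) (cupList s j)

/-- `headCupList` as a functional on chains. -/
noncomputable def headCup (s : ℕ → V → ZMod 2) (j : ℕ) : Chain V →ₗ[ZMod 2] ZMod 2 :=
  Finsupp.linearCombination (ZMod 2) (headCupList s j)

@[simp] lemma cup_single (s : ℕ → V → ZMod 2) (j : ℕ) (l : List V) :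
    cup s j (Finsupp.single l 1) = cupList s j l := by
  simp [cup]

@[simp] lemma headCup_single (s : ℕ → V → ZMod 2) (j : ℕ) (l : List V) :
    headCup s j (Finsupp.single l 1) = headCupList s j l := by
  simp [headCup]

lemma cup_cone_cone (s : ℕ → V → ZMod 2) (j : ℕ) (v w : V) (c : Chain V) :
    cup s j (cone v (cone w c)) = (s j v + s j w) * cup s (j + 1) (cone w c) := by
  have : (cup s j ∘ₗ cone v ∘ₗ cone w : Chain V →ₗ[ZMod 2] ZMod 2)
      = (s j v + s j w) • (cup s (j + 1) ∘ₗ cone w) := by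
    ext1 l
    ext1
    simp [cupList]
  exact LinearMap.congr_fun this c

lemma headCup_cone (s : ℕ → V → ZMod 2) (j : ℕ) (v : V) (c : Chain V) :
    headCup s j (cone v c) = s j v * cup s (j + 1) (cone v c) := by
  have : (headCup s j ∘ₗ cone v : Chain V →ₗ[ZMod 2] ZMod 2)
      = s j v • (cup s (j + 1) ∘ₗ cone v) := by
    ext1 l
    ext1
    simp [headCupList]
  exact LinearMap.congr_fun this c

lemma cup_cone_boundaryList (s : ℕ → V → ZMod 2) (j : ℕ) (v w : V) (l : List V) :
    cup s j (cone v (boundaryList (w :: l))) = cupList s j (w :: l) := by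
  induction l generalizing j v w with
  | nil => simp [boundaryList, cupList]
  | cons x l ih =>
    have h2 : s j v + s j v = 0 := CharTwo.add_self_eq_zero _
    rw [boundaryList, map_add, map_add, cup_cone_cone, ih]
    simp only [cone_single, cup_single, cupList]
    linear_combination cupList s (j + 1) (x :: l) * h2

lemma headCup_boundaryList (s : ℕ → V → ZMod 2) (j : ℕ) (v w : V) (l : List V) :
    headCup s j (boundaryList (v :: w :: l)) = cupList s j (v :: w :: l) := by
  rw [boundaryList, map_add, headCup_cone, cup_cone_boundaryList]
  simp only [headCup_single, headCupList, cupList]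
  ring

lemma headCup_boundary {s : ℕ → V → ZMod 2} {j : ℕ} {c : Chain V}
    (hc : c ∈ chainsIn {l : List V | 2 ≤ l.length}) : headCup s j (boundary c) = cup s j c := by
  refine eqOn_chainsIn (f := headCup s j ∘ₗ boundary) (fun l hl => ?_) hc
  match l, hl with
  | v :: w :: l, _ => simp [headCup_boundaryList]

lemma cupList_map_neg [Neg V] {s : ℕ → V → ZMod 2} {l : List V}
    (hs : ∀ j, ∀ v ∈ l, s j (-v) = s j v + 1) (j : ℕ) :
    cupList s j (l.map Neg.neg) = cupList s j l := by
  induction l generalizing j with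
  | nil => simp
  | cons v l ih =>
    match l with
    | [] => simp [cupList]
    | w :: l =>
      have h2 : (1 : ZMod 2) + 1 = 0 := by decide
      have := ih (fun j v hv => hs j v (List.mem_cons_of_mem _ hv)) (j + 1)
      simp only [List.map_cons] at this ⊢
      rw [cupList, cupList, this, hs j v (by simp), hs j w (by simp)]
      linear_combination cupList s (j + 1) (w :: l) * h2

lemma headCupList_map_neg [Neg V] {s : ℕ → V → ZMod 2} {v : V} {l : List V}
    (hs : ∀ j, ∀ w ∈ v :: l, s j (-w) = s j w + 1) (j : ℕ) :
    headCupList s j ((v :: l).map Neg.neg)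
      = headCupList s j (v :: l) + cupList s (j + 1) (v :: l) := by
  have := cupList_map_neg hs (j + 1)
  rw [List.map_cons] at this ⊢
  rw [headCupList, headCupList, this, hs j v (by simp)]
  ring

lemma headCup_add_mapChain_neg [Neg V] {s : ℕ → V → ZMod 2} {c : Chain V}
    (hc : c ∈ chainsIn {l : List V | l ≠ [] ∧ ∀ j, ∀ v ∈ l, s j (-v) = s j v + 1}) (j : ℕ) :
    headCup s j (c + mapChain Neg.neg c) = cup s (j + 1) c := by
  refine eqOn_chainsIn (f := headCup s j ∘ₗ (LinearMap.id + mapChain Neg.neg)) ?_ hc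
  rintro l ⟨hl, hs⟩
  match l, hl with
  | v :: l, _ =>
    have h2 : headCupList s j (v :: l) + headCupList s j (v :: l) = 0 :=
      CharTwo.add_self_eq_zero _
    have := headCupList_map_neg hs j
    simp only [LinearMap.coe_comp, Function.comp_apply, LinearMap.add_apply, LinearMap.id_coe,
      id_eq, map_add, mapChain_single, headCup_single, cup_single, this]
    linear_combination h2

lemma exists_ne_of_cupList_ne_zero {s : ℕ → V → ZMod 2} {j : ℕ} {l : List V}
    (h : cupList s j l ≠ 0) {i : ℕ} (hi : i + 1 < l.length) :
    ∃ v ∈ l, ∃ w ∈ l, s (j + i) v ≠ s (j + i) w := by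
  induction l generalizing j i with
  | nil => simp at hi
  | cons v l ih =>
    match l with
    | [] => simp at hi
    | w :: l =>
      rw [cupList] at h
      obtain ⟨h1, h2⟩ := mul_ne_zero_iff.mp h
      match i with
      | 0 =>
        refine ⟨v, by simp, w, by simp, fun he => h1 ?_⟩
        rw [add_zero] at he
        rw [he]
        exact CharTwo.add_self_eq_zero _
      | i + 1 =>
        obtain ⟨a, ha, b, hb, hab⟩ := ih h2 (i := i) (by simpa using hi)
        rw [show j + 1 + i = j + (i + 1) by ring] at hab
        exact ⟨a, List.mem_cons_of_mem _ ha, b, List.mem_cons_of_mem _ hb, hab⟩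

end Cochains

section Subdivision

variable {E : Type*} [NormedAddCommGroup E] [NormedSpace ℝ E]

/-- The barycenter of the vertices of a simplex. -/
noncomputable def barycenter (l : List E) : E := (l.length : ℝ)⁻¹ • l.sum

/-- Barycentric subdivision of chains of simplices with `n` vertices. -/
noncomputable def subdivide : ℕ → Chain E →ₗ[ZMod 2] Chain E
  | 0 => LinearMap.id
  | n + 1 => Finsupp.linearCombination (ZMod 2)
      fun l => cone (barycenter l) (subdivide n (boundaryList l))

lemma subdivide_succ_single (n : ℕ) (l : List E) :
    subdivide (n + 1) (Finsupp.single l 1)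
      = cone (barycenter l) (subdivide n (boundaryList l)) := by
  simp [subdivide]

lemma boundary_subdivide (n : ℕ) (c : Chain E) :
    boundary (subdivide (n + 1) c) = subdivide n (boundary c) := by
  have key (n : ℕ) (h : ∀ l : List E, boundary (subdivide n (boundaryList l)) = 0)
      (c : Chain E) : boundary (subdivide (n + 1) c) = subdivide n (boundary c) := by
    have : (boundary ∘ₗ subdivide (n + 1) : Chain E →ₗ[ZMod 2] Chain E)
        = subdivide n ∘ₗ boundary := by
      ext1 l
      ext1
      simp [subdivide_succ_single, boundary_cone, h]
    exact LinearMap.congr_fun this c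
  induction n generalizing c with
  | zero => exact key 0 boundary_boundaryList c
  | succ n ih =>
    refine key (n + 1) (fun l => ?_) c
    rw [ih, boundary_boundaryList, map_zero]

lemma barycenter_map_neg (l : List E) : barycenter (l.map Neg.neg) = -barycenter l := by
  have : (l.map Neg.neg).sum = -l.sum := by
    induction l with
    | nil => simp
    | cons v l ih => simp [ih, add_comm]
  simp [barycenter, this]

lemma mapChain_neg_subdivide (n : ℕ) (c : Chain E) :
    mapChain Neg.neg (subdivide n c) = subdivide n (mapChain Neg.neg c) := by
  induction n generalizing c with
  | zero => rfl
  | succ n ih =>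
    have : (mapChain Neg.neg ∘ₗ subdivide (n + 1) : Chain E →ₗ[ZMod 2] Chain E)
        = subdivide (n + 1) ∘ₗ mapChain Neg.neg := by
      ext1 l
      ext1
      simp [subdivide_succ_single, mapChain_cone, ih, mapChain_boundaryList, barycenter_map_neg]
    exact LinearMap.congr_fun this c

lemma norm_sum_sub_le {l : List E} {v : E} {r : ℝ} (h : ∀ w ∈ l, dist w v ≤ r) :
    ‖l.sum - (l.length : ℝ) • v‖ ≤ l.length * r := by
  induction l with
  | nil => simp
  | cons w l ih =>
    have h1 := ih fun x hx => h x (List.mem_cons_of_mem _ hx)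
    have h2 := h w (by simp)
    rw [dist_eq_norm] at h2
    have : (w :: l).sum - ((w :: l).length : ℝ) • v
        = (w - v) + (l.sum - (l.length : ℝ) • v) := by
      simp only [List.sum_cons, List.length_cons, Nat.cast_add, Nat.cast_one, add_smul, one_smul]
      abel
    rw [this]
    refine (norm_add_le _ _).trans ?_
    push_cast [List.length_cons]
    linarith

lemma dist_barycenter_le {l : List E} {M : ℕ} {r : ℝ} (hr : 0 ≤ r) (hl : l.length ≤ M + 1)
    (h : ∀ v ∈ l, ∀ w ∈ l, dist v w ≤ r) {v : E} (hv : v ∈ l) :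
    dist v (barycenter l) ≤ M / (M + 1) * r := by
  classical
  have hp := List.perm_cons_erase hv
  have hlen : (l.length : ℝ) = (l.erase v).length + 1 := by
    rw [hp.length_eq]; simp
  have h1 := norm_sum_sub_le (l := l.erase v) (v := v) (r := r)
    fun w hw => h w (List.mem_of_mem_erase hw) v hv
  set k := (l.erase v).length
  have hk : (k : ℝ) ≤ M := by
    have : (l.length : ℝ) ≤ M + 1 := by exact_mod_cast hl
    linarith
  have hk0 : (0 : ℝ) ≤ k := by positivity
  have h2 : barycenter l - v = (l.length : ℝ)⁻¹ • ((l.erase v).sum - (k : ℝ) • v) := by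
    have hne : (l.length : ℝ) ≠ 0 := by rw [hlen]; positivity
    have h4 : l.sum = v + (l.erase v).sum := by rw [hp.sum_eq, List.sum_cons]
    have h5 : (l.erase v).sum - (k : ℝ) • v = l.sum - (l.length : ℝ) • v := by
      rw [h4, hlen, add_smul, one_smul]
      abel
    rw [h5, smul_sub, smul_smul, inv_mul_cancel₀ hne, one_smul, barycenter]
  rw [dist_comm, dist_eq_norm, h2, norm_smul, norm_inv, Real.norm_natCast, hlen]
  calc ((k : ℝ) + 1)⁻¹ * ‖(l.erase v).sum - (k : ℝ) • v‖ ≤ ((k : ℝ) + 1)⁻¹ * (k * r) := by gcongr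
    _ = k / (k + 1) * r := by ring
    _ ≤ M / (M + 1) * r := by
      refine mul_le_mul_of_nonneg_right ?_ hr
      rw [div_le_div_iff₀ (by positivity) (by positivity)]
      nlinarith

lemma barycenter_mem_convexHull {l : List E} (hl : l ≠ []) :
    barycenter l ∈ convexHull ℝ {x | x ∈ l} := by
  have h0 : (l.length : ℝ) ≠ 0 := by simpa using hl
  have : barycenter l = ∑ i : Fin l.length, (l.length : ℝ)⁻¹ • l.get i := by
    rw [barycenter, ← Finset.smul_sum]
    simp [Fin.sum_univ_getElem]
  rw [this]
  refine (convex_convexHull ℝ _).sum_mem (fun _ _ => by positivity) (by simp [h0]) ?_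
  exact fun i _ => subset_convexHull ℝ _ (List.get_mem l i)

lemma subdivide_single_mem {M : ℕ} {r : ℝ} (hr : 0 ≤ r) (l : List E) (hl : l.length ≤ M + 1)
    (h : ∀ v ∈ l, ∀ w ∈ l, dist v w ≤ r) :
    subdivide l.length (Finsupp.single l 1) ∈ chainsIn {l' | l'.length = l.length ∧
      (∀ v ∈ l', v ∈ convexHull ℝ {x | x ∈ l}) ∧
      ∀ v ∈ l', ∀ w ∈ l', dist v w ≤ M / (M + 1) * r} := by
  induction hn : l.length generalizing l with
  | zero =>
    rw [List.length_eq_zero_iff] at hn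
    subst hn
    exact Finsupp.single_mem_supported _ _ (by simp)
  | succ n ih =>
    have hne : l ≠ [] := by rintro rfl; simp at hn
    rw [subdivide_succ_single]
    refine cone_mem (A := {l' | l'.length = n ∧
      (∀ v ∈ l', v ∈ convexHull ℝ {x | x ∈ l}) ∧
      ∀ v ∈ l', ∀ w ∈ l', dist v w ≤ M / (M + 1) * r}) ?_ ?_
    · rintro l' ⟨h1, h2, h3⟩
      have hb (v : E) (hv : v ∈ l') : dist v (barycenter l) ≤ M / (M + 1) * r := by
        have : convexHull ℝ {x | x ∈ l} ⊆ Metric.closedBall (barycenter l) (M / (M + 1) * r) :=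
          convexHull_min (fun x hx => dist_barycenter_le hr hl h hx) (convex_closedBall _ _)
        exact this (h2 v hv)
      refine ⟨by simp [h1], ?_, ?_⟩
      · intro v hv
        rcases List.mem_cons.mp hv with rfl | hv
        · exact barycenter_mem_convexHull hne
        · exact h2 v hv
      · intro v hv w hw
        rcases List.mem_cons.mp hv with rfl | hv <;> rcases List.mem_cons.mp hw with rfl | hw
        · rw [dist_self]; positivity
        · rw [dist_comm]; exact hb w hw
        · exact hb v hv
        · exact h3 v hv w hw
    · refine map_mem_of_single ?_ (boundaryList_mem l)
      rintro l' ⟨h1, h2⟩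
      have hl' : l'.length = n := by omega
      refine Finsupp.supported_mono ?_
        (ih l' (by omega) (fun v hv w hw => h v (h2 hv) w (h2 hw)) hl')
      rintro l'' ⟨h3, h4, h5⟩
      exact ⟨h3, fun v hv => convexHull_mono (fun x hx => h2 hx) (h4 v hv), h5⟩

/-- Simplices with `n` vertices and diameter at most `r`, lying in a hyperplane `f = 1` for a
functional `f` bounded by `C`. -/
def fineSimplices (E : Type*) [NormedAddCommGroup E] [NormedSpace ℝ E] (C r : ℝ) (n : ℕ) :
    Set (List E) :=
  {l | l.length = n ∧ (∃ f : E →ₗ[ℝ] ℝ, (∀ x, |f x| ≤ C * ‖x‖) ∧ ∀ v ∈ l, f v = 1) ∧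
    ∀ v ∈ l, ∀ w ∈ l, dist v w ≤ r}

lemma subdivide_mem {C r : ℝ} {n M : ℕ} (hr : 0 ≤ r) (hn : n ≤ M + 1) {c : Chain E}
    (hc : c ∈ chainsIn (fineSimplices E C r n)) :
    subdivide n c ∈ chainsIn (fineSimplices E C (M / (M + 1) * r) n) := by
  refine map_mem_of_single ?_ hc
  rintro l ⟨rfl, ⟨f, hf, hfl⟩, hd⟩
  refine Finsupp.supported_mono ?_ (subdivide_single_mem hr l hn hd)
  rintro l' ⟨h1, h2, h3⟩
  refine ⟨h1, ⟨f, hf, fun v hv => ?_⟩, h3⟩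
  have : convexHull ℝ {x | x ∈ l} ⊆ {x | f x = 1} :=
    convexHull_min (fun x hx => hfl x hx) (convex_hyperplane f.isLinear 1)
  exact this (h2 v hv)

lemma iterate_subdivide_mem {C r : ℝ} {n M : ℕ} (hr : 0 ≤ r) (hn : n ≤ M + 1) {c : Chain E}
    (hc : c ∈ chainsIn (fineSimplices E C r n)) (N : ℕ) :
    (subdivide n)^[N] c ∈ chainsIn (fineSimplices E C ((M / (M + 1)) ^ N * r) n) := by
  induction N with
  | zero => simpa using hc
  | succ N ih =>
    rw [Function.iterate_succ_apply', pow_succ', mul_assoc]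
    exact subdivide_mem (by positivity) hn ih

end Subdivision

section CrossPolytope

variable {E : Type*} [AddCommGroup E]

/-- The fundamental cycle of the boundary of the cross-polytope on `±e 0, …, ±e (d - 1)`. -/
noncomputable def crossPolytope (e : ℕ → E) : ℕ → Chain E
  | 0 => Finsupp.single [] 1
  | d + 1 => cone (e d) (crossPolytope e d) + cone (-e d) (crossPolytope e d)

lemma boundary_crossPolytope (e : ℕ → E) (d : ℕ) : boundary (crossPolytope e d) = 0 := by
  induction d with
  | zero => simp [crossPolytope, boundaryList]
  | succ d ih => simp [crossPolytope, boundary_cone, ih, ZModModule.add_self]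

lemma boundary_cone_crossPolytope (e : ℕ → E) (v : E) (d : ℕ) :
    boundary (cone v (crossPolytope e d)) = crossPolytope e d := by
  simp [boundary_cone, boundary_crossPolytope]

lemma mapChain_neg_crossPolytope (e : ℕ → E) (d : ℕ) :
    mapChain Neg.neg (crossPolytope e d) = crossPolytope e d := by
  induction d with
  | zero => simp [crossPolytope]
  | succ d ih => simp [crossPolytope, mapChain_cone, ih, add_comm]

lemma crossPolytope_succ (e : ℕ → E) (d : ℕ) :
    crossPolytope e (d + 1) = cone (e d) (crossPolytope e d)
      + mapChain Neg.neg (cone (e d) (crossPolytope e d)) := by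
  rw [mapChain_cone, mapChain_neg_crossPolytope, crossPolytope]

variable [Module ℝ E]

/-- The simplices with `d` vertices, each of the form `ε i • e i` with `i < d`, for a fixed choice
of signs `ε`. -/
def signedSimplices (e : ℕ → E) (d : ℕ) : Set (List E) :=
  {l | l.length = d ∧ ∃ ε : ℕ → ℝ, (∀ i, ε i = 1 ∨ ε i = -1) ∧
    ∀ v ∈ l, ∃ i < d, v = ε i • e i}

lemma cons_mem_signedSimplices {e : ℕ → E} {d : ℕ} {a : ℝ} (ha : a = 1 ∨ a = -1) {l : List E}
    (hl : l ∈ signedSimplices e d) : a • e d :: l ∈ signedSimplices e (d + 1) := by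
  obtain ⟨h1, ε, h2, h3⟩ := hl
  refine ⟨by simp [h1], Function.update ε d a, fun i => ?_, fun v hv => ?_⟩
  · rcases eq_or_ne i d with rfl | hi
    · simpa using ha
    · simpa [hi] using h2 i
  · rcases List.mem_cons.mp hv with rfl | hv
    · exact ⟨d, by omega, by simp⟩
    · obtain ⟨i, hi, rfl⟩ := h3 v hv
      exact ⟨i, by omega, by simp [hi.ne]⟩

lemma cone_mem_signedSimplices {e : ℕ → E} {d : ℕ} {c : Chain E}
    (hc : c ∈ chainsIn (signedSimplices e d)) :
    cone (e d) c ∈ chainsIn (signedSimplices e (d + 1)) :=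
  cone_mem (fun l hl => by
    simpa only [one_smul] using cons_mem_signedSimplices (Or.inl rfl) hl) hc

lemma crossPolytope_mem (e : ℕ → E) (d : ℕ) :
    crossPolytope e d ∈ chainsIn (signedSimplices e d) := by
  induction d with
  | zero => exact Finsupp.single_mem_supported _ _ ⟨rfl, 1, by simp, by simp⟩
  | succ d ih =>
    refine Submodule.add_mem _ (cone_mem_signedSimplices ih) (cone_mem (fun l hl => ?_) ih)
    simpa only [neg_smul, one_smul] using cons_mem_signedSimplices (Or.inr rfl) hl

end CrossPolytope

section BorsukUlam

variable {n : ℕ}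

/-- The standard basis of `ℝ ^ (n + 1)`, extended by zero. -/
noncomputable def stdBasis (n i : ℕ) : EuclideanSpace ℝ (Fin (n + 1)) :=
  if h : i < n + 1 then EuclideanSpace.single ⟨i, h⟩ 1 else 0

lemma norm_stdBasis_le (i : ℕ) : ‖stdBasis n i‖ ≤ 1 := by
  unfold stdBasis
  split_ifs <;> simp

lemma signedSimplices_stdBasis_subset {d : ℕ} (hd : d ≤ n + 1) :
    signedSimplices (stdBasis n) d
      ⊆ fineSimplices (EuclideanSpace ℝ (Fin (n + 1))) (n + 1) 2 d := by
  rintro l ⟨h1, ε, h2, h3⟩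
  have habs (i : ℕ) : |ε i| = 1 := by rcases h2 i with h | h <;> simp [h]
  refine ⟨h1, ⟨∑ i : Fin (n + 1), ε i • (EuclideanSpace.proj (𝕜 := ℝ) i).toLinearMap,
    fun x => ?_, fun v hv => ?_⟩, fun v hv w hw => ?_⟩
  · simp only [LinearMap.coe_sum, Finset.sum_apply, LinearMap.smul_apply, smul_eq_mul]
    refine (Finset.abs_sum_le_sum_abs _ _).trans ?_
    refine (Finset.sum_le_card_nsmul _ _ ‖x‖ fun i _ => ?_).trans ?_
    · rw [abs_mul, habs, one_mul]
      exact PiLp.norm_apply_le x i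
    · simp
  · obtain ⟨i, hi, rfl⟩ := h3 v hv
    have hi' : i < n + 1 := by omega
    have : ε i * ε i = 1 := by rcases h2 i with h | h <;> simp [h]
    rw [stdBasis, dif_pos hi', LinearMap.sum_apply, Finset.sum_eq_single ⟨i, hi'⟩]
    · simpa using this
    · intro j _ hj
      simp [hj]
    · simp
  · have key (v) (hv : v ∈ l) : ‖v‖ ≤ 1 := by
      obtain ⟨i, hi, rfl⟩ := h3 v hv
      rw [norm_smul, Real.norm_eq_abs, habs, one_mul]
      exact norm_stdBasis_le i
    exact (dist_le_norm_add_norm v w).trans (by linarith [key v hv, key w hw])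

lemma ne_zero_of_mem_fineSimplices {E : Type*} [NormedAddCommGroup E] [NormedSpace ℝ E]
    {C r : ℝ} {d : ℕ} {l : List E} (hl : l ∈ fineSimplices E C r d) {v : E} (hv : v ∈ l) :
    v ≠ 0 := by
  obtain ⟨-, ⟨f, -, hf⟩, -⟩ := hl
  rintro rfl
  simpa using hf 0 hv

/-- The `N`-th subdivision of the upper half of the boundary of the cross-polytope of dimension
`d + 1`. -/
noncomputable def hemisphere (n N d : ℕ) : Chain (EuclideanSpace ℝ (Fin (n + 1))) :=
  (subdivide (d + 1))^[N] (cone (stdBasis n d) (crossPolytope (stdBasis n) d))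

lemma hemisphere_mem (N : ℕ) {d : ℕ} (hd : d ≤ n) :
    hemisphere n N d ∈ chainsIn (fineSimplices (EuclideanSpace ℝ (Fin (n + 1))) (n + 1)
      ((n / (n + 1)) ^ N * 2) (d + 1)) :=
  iterate_subdivide_mem (by norm_num) (by omega)
    (Finsupp.supported_mono (signedSimplices_stdBasis_subset (by omega))
      (cone_mem_signedSimplices (crossPolytope_mem _ _))) N

lemma boundary_hemisphere (N d : ℕ) :
    boundary (hemisphere n N (d + 1))
      = hemisphere n N d + mapChain Neg.neg (hemisphere n N d) := by
  have h1 : Function.Semiconj (boundary (V := EuclideanSpace ℝ (Fin (n + 1))))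
      (subdivide (d + 1 + 1)) (subdivide (d + 1)) := boundary_subdivide (d + 1)
  have h2 : Function.Semiconj (mapChain (V := EuclideanSpace ℝ (Fin (n + 1))) Neg.neg)
      (subdivide (d + 1)) (subdivide (d + 1)) := mapChain_neg_subdivide (d + 1)
  rw [hemisphere, hemisphere, (h1.iterate_right N).eq, (h2.iterate_right N).eq,
    boundary_cone_crossPolytope, crossPolytope_succ, ← Module.End.coe_pow, map_add]

lemma cup_hemisphere {s : ℕ → EuclideanSpace ℝ (Fin (n + 1)) → ZMod 2}
    (hs : ∀ j v, v ≠ 0 → s j (-v) = s j v + 1) (N j : ℕ) {d : ℕ} (hd : d ≤ n) :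
    cup s j (hemisphere n N d) = 1 := by
  induction d generalizing j with
  | zero =>
    have : hemisphere n N 0 = Finsupp.single [stdBasis n 0] 1 := by
      rw [hemisphere, crossPolytope, cone_single]
      refine Function.iterate_fixed ?_ N
      simp [boundaryList, subdivide, barycenter]
    rw [this, cup_single, cupList]
  | succ d ih =>
    rw [← headCup_boundary, boundary_hemisphere, headCup_add_mapChain_neg, ih _ (by omega)]
    · refine Finsupp.supported_mono (fun l hl => ?_) (hemisphere_mem N (d := d) (by omega))
      refine ⟨fun h => ?_, fun j v hv => hs j v (ne_zero_of_mem_fineSimplices hl hv)⟩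
      have := hl.1
      simp [h] at this
    · refine Finsupp.supported_mono (fun l hl => ?_) (hemisphere_mem N hd)
      have := hl.1
      change 2 ≤ l.length
      omega

lemma exists_mem_fineSimplices {s : ℕ → EuclideanSpace ℝ (Fin (n + 1)) → ZMod 2}
    (hs : ∀ j v, v ≠ 0 → s j (-v) = s j v + 1) {δ : ℝ} (hδ : 0 < δ) :
    ∃ l ∈ fineSimplices (EuclideanSpace ℝ (Fin (n + 1))) (n + 1) δ (n + 1),
      ∀ j < n, ∃ v ∈ l, ∃ w ∈ l, s j v ≠ s j w := by
  obtain ⟨N, hN⟩ : ∃ N : ℕ, ((n : ℝ) / (n + 1)) ^ N < δ / 2 :=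
    exists_pow_lt_of_lt_one (by positivity) (by rw [div_lt_one (by positivity)]; linarith)
  by_contra! hcon
  have h1 := cup_hemisphere hs N 0 le_rfl
  have h2 : cup s 0 (hemisphere n N n) ∈ (⊥ : Submodule (ZMod 2) (ZMod 2)) := by
    refine map_mem_of_single (fun l hl => ?_) (hemisphere_mem N le_rfl)
    rw [cup_single, Submodule.mem_bot]
    by_contra h0
    obtain ⟨j, hj, hc⟩ := hcon l ⟨hl.1, hl.2.1, fun v hv w hw =>
      (hl.2.2 v hv w hw).trans (by linarith)⟩
    obtain ⟨v, hv, w, hw, hvw⟩ := exists_ne_of_cupList_ne_zero h0 (i := j)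
      (by rw [hl.1]; omega)
    rw [zero_add] at hvw
    exact hvw (hc v hv w hw)
  rw [h1, Submodule.mem_bot] at h2
  exact one_ne_zero h2

lemma dist_normalize_le {E : Type*} [NormedAddCommGroup E] [NormedSpace ℝ E] {v w : E}
    (hv : v ≠ 0) (hw : w ≠ 0) :
    dist (‖v‖⁻¹ • v) (‖w‖⁻¹ • w) ≤ 2 * ‖v‖⁻¹ * dist v w := by
  have hv' : ‖v‖ ≠ 0 := norm_ne_zero_iff.mpr hv
  have hw' : ‖w‖ ≠ 0 := norm_ne_zero_iff.mpr hw
  have h : ‖v‖⁻¹ • v - ‖w‖⁻¹ • w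
      = ‖v‖⁻¹ • (v - w) + (‖v‖⁻¹ * (‖w‖ - ‖v‖)) • (‖w‖⁻¹ • w) := by
    rw [smul_smul, smul_sub, sub_add, ← sub_smul]
    congr 2
    field_simp
    ring
  rw [dist_eq_norm, dist_eq_norm, h]
  refine (norm_add_le _ _).trans ?_
  rw [norm_smul, norm_smul, norm_smul, norm_mul, norm_inv, norm_inv, norm_norm, norm_norm,
    inv_mul_cancel₀ hw', mul_one]
  have h3 : ‖‖w‖ - ‖v‖‖ ≤ ‖v - w‖ := by
    rw [norm_sub_rev v w]
    exact abs_norm_sub_norm_le w v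
  have := mul_le_mul_of_nonneg_left h3 (inv_nonneg.mpr (norm_nonneg v))
  linarith

/-- A discrete form of the Borsuk–Ulam theorem: `n` odd sign functions on the `n`-sphere are
simultaneously non-constant on arbitrarily small sets. -/
theorem exists_small_list_nonconstant {s : ℕ → EuclideanSpace ℝ (Fin (n + 1)) → ZMod 2}
    (hs : ∀ j, ∀ v ∈ Metric.sphere 0 1, s j (-v) = s j v + 1) {δ : ℝ} (hδ : 0 < δ) :
    ∃ l : List (EuclideanSpace ℝ (Fin (n + 1))), l ≠ [] ∧ (∀ v ∈ l, v ∈ Metric.sphere 0 1) ∧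
      (∀ v ∈ l, ∀ w ∈ l, dist v w ≤ δ) ∧ ∀ j < n, ∃ v ∈ l, ∃ w ∈ l, s j v ≠ s j w := by
  have hnorm (v : EuclideanSpace ℝ (Fin (n + 1))) (hv : v ≠ 0) :
      ‖v‖⁻¹ • v ∈ Metric.sphere (0 : EuclideanSpace ℝ (Fin (n + 1))) 1 := by
    rw [mem_sphere_zero_iff_norm, norm_smul, norm_inv, norm_norm,
      inv_mul_cancel₀ (norm_ne_zero_iff.mpr hv)]
  obtain ⟨l, hl, hne⟩ := exists_mem_fineSimplices (s := fun j v => s j (‖v‖⁻¹ • v))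
    (fun j v hv => by
      simp only [norm_neg, smul_neg]
      exact hs j _ (hnorm v hv))
    (δ := δ / (2 * (n + 1))) (by positivity)
  have h0 (v) (hv : v ∈ l) : v ≠ 0 := ne_zero_of_mem_fineSimplices hl hv
  obtain ⟨hlen, ⟨f, hf, hf1⟩, hd⟩ := hl
  refine ⟨l.map fun v => ‖v‖⁻¹ • v, ?_, ?_, ?_, fun j hj => ?_⟩
  · intro h
    rw [List.map_eq_nil_iff] at h
    simp [h] at hlen
  · simp only [List.forall_mem_map]
    exact fun v hv => hnorm v (h0 v hv)
  · simp only [List.forall_mem_map]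
    intro v hv w hw
    have h1 : ‖v‖⁻¹ ≤ n + 1 := by
      have := hf v
      rw [hf1 v hv, abs_one] at this
      rwa [inv_le_iff_one_le_mul₀ (norm_pos_iff.mpr (h0 v hv))]
    calc dist (‖v‖⁻¹ • v) (‖w‖⁻¹ • w) ≤ 2 * ‖v‖⁻¹ * dist v w :=
          dist_normalize_le (h0 v hv) (h0 w hw)
      _ ≤ 2 * (n + 1) * (δ / (2 * (n + 1))) := by
          gcongr
          exact hd v hv w hw
      _ = δ := by field_simp
  · obtain ⟨v, hv, w, hw, h⟩ := hne j hj
    exact ⟨_, List.mem_map_of_mem hv, _, List.mem_map_of_mem hw, h⟩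

end BorsukUlam

section AlternatingChains

variable {α : Type*}

/-- Some sequence of `k + 1` elements of `Y` with consecutive elements related by `R` ends in
`x`. -/
def EndsChain (R : α → α → Prop) (Y : Set α) : ℕ → α → Prop
  | 0, x => x ∈ Y
  | k + 1, x => x ∈ Y ∧ ∃ y, EndsChain R Y k y ∧ R y x

lemma EndsChain.mono {R : α → α → Prop} {Y Z : Set α} (h : Y ⊆ Z) {k : ℕ} {x : α}
    (hx : EndsChain R Y k x) : EndsChain R Z k x := by
  induction k generalizing x with
  | zero => exact h hx
  | succ k ih =>
    obtain ⟨h1, y, h2, h3⟩ := hx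
    exact ⟨h h1, y, ih h2, h3⟩

lemma EndsChain.mem {R : α → α → Prop} {Y : Set α} {k : ℕ} {x : α}
    (hx : EndsChain R Y k x) : x ∈ Y := by
  cases k with
  | zero => exact hx
  | succ k => exact hx.1

lemma EndsChain.exists_seq {R : α → α → Prop} {Y : Set α} {k : ℕ} {x : α}
    (hx : EndsChain R Y k x) :
    ∃ y : ℕ → α, (∀ i ≤ k, y i ∈ Y) ∧ (∀ i < k, R (y i) (y (i + 1))) ∧ y k = x := by
  induction k generalizing x with
  | zero => exact ⟨fun _ => x, fun _ _ => hx, by simp, rfl⟩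
  | succ k ih =>
    obtain ⟨h1, z, h2, h3⟩ := hx
    obtain ⟨y, hy1, hy2, rfl⟩ := ih h2
    refine ⟨fun i => if i ≤ k then y i else x, fun i hi => ?_, fun i hi => ?_, by simp⟩
    · dsimp only
      split_ifs with h
      · exact hy1 i h
      · exact h1
    · rcases (Nat.lt_succ_iff.mp hi).lt_or_eq with h | rfl
      · simpa [h.le, Nat.succ_le_of_lt h] using hy2 i h
      · simpa using h3

variable {ι : Type*}

/-- Signed elements increasing in both `r₁` and `r₂`, with opposite signs. -/
def altRel (r₁ r₂ : ι → ι → Prop) (x y : ι × Bool) : Prop :=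
  r₁ x.1 y.1 ∧ r₂ x.1 y.1 ∧ y.2 = !x.2

/-- Reversal of all signs. -/
def flipSigns (Y : Set (ι × Bool)) : Set (ι × Bool) := {x | (x.1, !x.2) ∈ Y}

lemma endsChain_flipSigns {r₁ r₂ : ι → ι → Prop} {Y : Set (ι × Bool)} {k : ℕ} {x : ι × Bool} :
    EndsChain (altRel r₁ r₂) (flipSigns Y) k x ↔ EndsChain (altRel r₁ r₂) Y k (x.1, !x.2) := by
  induction k generalizing x with
  | zero => rfl
  | succ k ih =>
    refine and_congr Iff.rfl ⟨?_, ?_⟩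
    · rintro ⟨y, h1, h2, h3, h4⟩
      exact ⟨(y.1, !y.2), ih.mp h1, h2, h3, by simp [h4]⟩
    · rintro ⟨y, h1, h2, h3, h4⟩
      exact ⟨(y.1, !y.2), ih.mpr (by simpa using h1), h2, h3, by simpa using h4⟩

/-- `x` ends an alternating chain with `q.1 + 1` elements increasing in both orders, and an
alternating chain with `q.2 + 1` elements increasing in `r₁` and decreasing in `r₂`. -/
def EndsChains (r₁ r₂ : ι → ι → Prop) (Y : Set (ι × Bool)) (q : ℕ × ℕ) (x : ι × Bool) : Prop :=
  EndsChain (altRel r₁ r₂) Y q.1 x ∧ EndsChain (altRel r₁ (Function.swap r₂)) Y q.2 x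

lemma EndsChains.mono {r₁ r₂ : ι → ι → Prop} {Y Z : Set (ι × Bool)} (h : Y ⊆ Z) {q : ℕ × ℕ}
    {x : ι × Bool} (hx : EndsChains r₁ r₂ Y q x) : EndsChains r₁ r₂ Z q x :=
  ⟨hx.1.mono h, hx.2.mono h⟩

lemma endsChains_flipSigns {r₁ r₂ : ι → ι → Prop} {Y : Set (ι × Bool)} {q : ℕ × ℕ}
    {x : ι × Bool} :
    EndsChains r₁ r₂ (flipSigns Y) q x ↔ EndsChains r₁ r₂ Y q (x.1, !x.2) :=
  and_congr endsChain_flipSigns endsChain_flipSigns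

open Classical in
/-- The pairs of chain lengths below `p` realised by elements of `Y`. -/
noncomputable def chainLengths (r₁ r₂ : ι → ι → Prop) (p : ℕ) (Y : Set (ι × Bool)) :
    Finset (ℕ × ℕ) :=
  (Finset.range p ×ˢ Finset.range p).filter fun q => ∃ x, EndsChains r₁ r₂ Y q x

lemma chainLengths_mono {r₁ r₂ : ι → ι → Prop} {p : ℕ} {Y Z : Set (ι × Bool)} (h : Y ⊆ Z) :
    chainLengths r₁ r₂ p Y ⊆ chainLengths r₁ r₂ p Z := by
  intro q
  simp only [chainLengths, Finset.mem_filter]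
  exact fun ⟨h1, x, h2⟩ => ⟨h1, x, h2.mono h⟩

lemma chainLengths_flipSigns {r₁ r₂ : ι → ι → Prop} {p : ℕ} {Y : Set (ι × Bool)} :
    chainLengths r₁ r₂ p (flipSigns Y) = chainLengths r₁ r₂ p Y := by
  ext q
  simp only [chainLengths, Finset.mem_filter, endsChains_flipSigns]
  refine and_congr Iff.rfl ⟨fun ⟨x, hx⟩ => ⟨_, hx⟩, fun ⟨x, hx⟩ => ⟨(x.1, !x.2), ?_⟩⟩
  simpa using hx

lemma exists_corner (D : Finset (ℕ × ℕ)) :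
    ∃ q : ℕ × ℕ, D.Nonempty → q ∈ D ∧ ∀ q' ∈ D, q'.1 + q'.2 ≤ q.1 + q.2 := by
  rcases D.eq_empty_or_nonempty with rfl | h
  · exact ⟨0, fun h => absurd h Finset.not_nonempty_empty⟩
  · obtain ⟨q, h1, h2⟩ := D.exists_max_image (fun q => q.1 + q.2) h
    exact ⟨q, fun _ => ⟨h1, h2⟩⟩

/-- An element of `D` with maximal sum of coordinates. -/
noncomputable def corner (D : Finset (ℕ × ℕ)) : ℕ × ℕ := (exists_corner D).choose

lemma corner_mem {D : Finset (ℕ × ℕ)} (h : D.Nonempty) : corner D ∈ D :=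
  ((exists_corner D).choose_spec h).1

lemma le_corner {D : Finset (ℕ × ℕ)} {q : ℕ × ℕ} (h : q ∈ D) :
    q.1 + q.2 ≤ (corner D).1 + (corner D).2 :=
  ((exists_corner D).choose_spec ⟨q, h⟩).2 q h

/-- Nonempty sets of signed elements without opposite elements, all of whose alternating chains
that are monotone in both orders have at most `p` elements. -/
structure Admissible (r₁ r₂ : ι → ι → Prop) (p : ℕ) (Y : Set (ι × Bool)) : Prop where
  nonempty : Y.Nonempty
  consistent : ∀ i, (i, true) ∈ Y → (i, false) ∉ Y
  not_increasing : ∀ x, ¬ EndsChain (altRel r₁ r₂) Y p x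
  not_decreasing : ∀ x, ¬ EndsChain (altRel r₁ (Function.swap r₂)) Y p x

open Classical in
/-- The sign of the elements realising the corner of the set of chain lengths. -/
noncomputable def cornerSign (r₁ r₂ : ι → ι → Prop) (p : ℕ) (Y : Set (ι × Bool)) : ZMod 2 :=
  if ∃ i, EndsChains r₁ r₂ Y (corner (chainLengths r₁ r₂ p Y)) (i, true) then 1 else 0

namespace Admissible

variable {r₁ r₂ : ι → ι → Prop} {p : ℕ} {Y Z : Set (ι × Bool)}

lemma chainLengths_nonempty (h : Admissible r₁ r₂ p Y) :
    (chainLengths r₁ r₂ p Y).Nonempty := by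
  obtain ⟨x, hx⟩ := h.nonempty
  have hp : p ≠ 0 := by
    rintro rfl
    exact h.not_increasing x hx
  exact ⟨(0, 0), by
    simp only [chainLengths, Finset.mem_filter, Finset.mem_product, Finset.mem_range]
    exact ⟨⟨by omega, by omega⟩, x, hx, hx⟩⟩

lemma exists_endsChains (h : Admissible r₁ r₂ p Y) :
    ∃ x, EndsChains r₁ r₂ Y (corner (chainLengths r₁ r₂ p Y)) x := by
  have hc := corner_mem h.chainLengths_nonempty
  generalize corner (chainLengths r₁ r₂ p Y) = c at hc ⊢
  simp only [chainLengths, Finset.mem_filter] at hc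
  exact hc.2

lemma false_of_lt (h : Admissible r₁ r₂ p Y) (ht : ∀ i j, r₂ i j ∨ i = j ∨ r₂ j i)
    (hirr : ∀ i, ¬ r₁ i i) {x y : ι × Bool}
    (hx : EndsChains r₁ r₂ Y (corner (chainLengths r₁ r₂ p Y)) x)
    (hy : EndsChains r₁ r₂ Y (corner (chainLengths r₁ r₂ p Y)) y)
    (hxy : r₁ x.1 y.1) (hs : y.2 = !x.2) : False := by
  have hmem := corner_mem h.chainLengths_nonempty
  have hmax := fun q => le_corner (D := chainLengths r₁ r₂ p Y) (q := q)
  set c := corner (chainLengths r₁ r₂ p Y)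
  simp only [chainLengths, Finset.mem_filter, Finset.mem_product, Finset.mem_range]
    at hmem hmax
  rcases ht x.1 y.1 with h2 | h2 | h2
  · have h3 : EndsChain (altRel r₁ r₂) Y (c.1 + 1) y := ⟨hy.1.mem, x, hx.1, hxy, h2, hs⟩
    have h4 : c.1 + 1 ≠ p := fun he => h.not_increasing y (he ▸ h3)
    have := hmax (c.1 + 1, c.2) ⟨⟨by omega, hmem.1.2⟩, y, h3, hy.2⟩
    simp only at this
    omega
  · rw [h2] at hxy
    exact hirr _ hxy
  · have h3 : EndsChain (altRel r₁ (Function.swap r₂)) Y (c.2 + 1) y :=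
      ⟨hy.2.mem, x, hx.2, hxy, h2, hs⟩
    have h4 : c.2 + 1 ≠ p := fun he => h.not_decreasing y (he ▸ h3)
    have := hmax (c.1, c.2 + 1) ⟨⟨hmem.1.1, by omega⟩, y, hy.1, h3⟩
    simp only at this
    omega

lemma snd_eq [IsStrictTotalOrder ι r₁] [IsStrictTotalOrder ι r₂] (h : Admissible r₁ r₂ p Y)
    {x y : ι × Bool}
    (hx : EndsChains r₁ r₂ Y (corner (chainLengths r₁ r₂ p Y)) x)
    (hy : EndsChains r₁ r₂ Y (corner (chainLengths r₁ r₂ p Y)) y) : x.2 = y.2 := by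
  by_contra hne
  have ht := fun i j => trichotomous_of r₂ i j
  have hirr := fun i => irrefl_of r₁ i
  rcases trichotomous_of r₁ x.1 y.1 with h1 | h1 | h1
  · exact h.false_of_lt ht hirr hx hy h1 (by grind)
  · have hxY := hx.1.mem
    have hyY := hy.1.mem
    obtain ⟨i, a⟩ := x
    obtain ⟨j, b⟩ := y
    obtain rfl : i = j := h1
    have hc := h.consistent i
    cases a <;> cases b <;> simp_all
  · exact h.false_of_lt ht hirr hy hx h1 (by grind)

lemma cornerSign_eq [IsStrictTotalOrder ι r₁] [IsStrictTotalOrder ι r₂]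
    (h : Admissible r₁ r₂ p Y) {x : ι × Bool}
    (hx : EndsChains r₁ r₂ Y (corner (chainLengths r₁ r₂ p Y)) x) :
    cornerSign r₁ r₂ p Y = if x.2 then 1 else 0 := by
  obtain ⟨i, b⟩ := x
  unfold cornerSign
  cases b with
  | true => rw [if_pos ⟨i, hx⟩]; rfl
  | false =>
    rw [if_neg]
    · rfl
    · rintro ⟨j, hj⟩
      simpa using h.snd_eq hx hj

lemma cornerSign_eq_of_subset [IsStrictTotalOrder ι r₁] [IsStrictTotalOrder ι r₂]
    (hY : Admissible r₁ r₂ p Y) (hZ : Admissible r₁ r₂ p Z) (h : Y ⊆ Z)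
    (hc : (chainLengths r₁ r₂ p Y).card = (chainLengths r₁ r₂ p Z).card) :
    cornerSign r₁ r₂ p Y = cornerSign r₁ r₂ p Z := by
  have he := Finset.eq_of_subset_of_card_le (chainLengths_mono h) hc.ge
  obtain ⟨x, hx⟩ := hY.exists_endsChains
  rw [hY.cornerSign_eq hx, hZ.cornerSign_eq (x := x) (he ▸ hx.mono h)]

lemma flipSigns (h : Admissible r₁ r₂ p Y) : Admissible r₁ r₂ p (flipSigns Y) where
  nonempty := by
    obtain ⟨x, hx⟩ := h.nonempty
    exact ⟨(x.1, !x.2), by simpa [KyFan.flipSigns] using hx⟩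
  consistent i h1 h2 := h.consistent i h2 h1
  not_increasing _ hx := h.not_increasing _ (endsChain_flipSigns.mp hx)
  not_decreasing _ hx := h.not_decreasing _ (endsChain_flipSigns.mp hx)

lemma cornerSign_flipSigns [IsStrictTotalOrder ι r₁] [IsStrictTotalOrder ι r₂]
    (h : Admissible r₁ r₂ p Y) :
    cornerSign r₁ r₂ p (KyFan.flipSigns Y) = cornerSign r₁ r₂ p Y + 1 := by
  obtain ⟨x, hx⟩ := h.exists_endsChains
  have hx' : EndsChains r₁ r₂ (KyFan.flipSigns Y)
      (corner (chainLengths r₁ r₂ p (KyFan.flipSigns Y))) (x.1, !x.2) := by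
    rw [chainLengths_flipSigns, endsChains_flipSigns]
    simpa using hx
  rw [h.cornerSign_eq hx, h.flipSigns.cornerSign_eq hx']
  cases x.2 <;> rfl

lemma card_chainLengths_sub_one_lt (h : Admissible r₁ r₂ p Y) :
    (chainLengths r₁ r₂ p Y).card - 1 < p * p := by
  have h1 : (chainLengths r₁ r₂ p Y).card ≤ p * p := by
    classical
    rw [chainLengths]
    refine (Finset.card_filter_le _ _).trans ?_
    simp
  have h2 := h.chainLengths_nonempty.card_pos
  omega

end Admissible

end AlternatingChains

section Thresholds

lemma exists_eq_succ_of_monotone {α : Type*} [Finite α] {f : ℕ → Set α} (hf : Monotone f) :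
    ∃ q ≤ Nat.card α, f q = f (q + 1) := by
  by_contra! h
  have key (q : ℕ) (hq : q ≤ Nat.card α + 1) : q ≤ (f q).ncard := by
    induction q with
    | zero => omega
    | succ q ih =>
      have h1 : f q ⊂ f (q + 1) := (hf q.le_succ).ssubset_of_ne (h q (by omega))
      have := Set.ncard_lt_ncard h1 (Set.toFinite _)
      have := ih (by omega)
      omega
  have h1 := key _ le_rfl
  have h2 := Set.ncard_le_card (f (Nat.card α + 1))
  omega

open Classical in
/-- An odd sign function on the nonzero vectors. -/
noncomputable def oddSign {E : Type*} [Neg E] (v : E) : ZMod 2 :=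
  if WellOrderingRel v (-v) then 1 else 0

lemma oddSign_neg {E : Type*} [InvolutiveNeg E] {v : E} (h : v ≠ -v) :
    oddSign (-v) = oddSign v + 1 := by
  unfold oddSign
  rw [neg_neg]
  rcases trichotomous_of WellOrderingRel v (-v) with h1 | h1 | h1
  · rw [if_pos h1, if_neg (asymm_of WellOrderingRel h1)]
    decide
  · exact absurd h1 h
  · rw [if_pos h1, if_neg (asymm_of WellOrderingRel h1)]
    decide

open Classical in
/-- The common sign of the sets labelled `j` among `X t v` with `0 ≤ t ≤ δ`, if there are any. -/
noncomputable def labelSign {E α : Type*} [Neg E] (X : ℝ → E → Set α) (N : Set α → ℕ)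
    (σ : Set α → ZMod 2) (δ : ℝ) (j : ℕ) (v : E) : ZMod 2 :=
  if h : ∃ t ∈ Set.Icc 0 δ, N (X t v) = j then σ (X h.choose v) else oddSign v

/-- There is no antipodal labelling with `n` labels of the sets `X t v`, which grow with `t` and
vary by a bounded shift of `t` with `v`, such that comparable sets never have opposite labels. -/
theorem false_of_labelling {n : ℕ} {α : Type*} [Finite α]
    {X : ℝ → EuclideanSpace ℝ (Fin (n + 1)) → Set α} {δ : ℝ} (hδ : 0 < δ)
    (hX : ∀ t t' u v, dist u v + t ≤ t' → X t u ⊆ X t' v)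
    {flip : Set α → Set α} (hflip : ∀ t u, X t (-u) = flip (X t u))
    {P : Set α → Prop} (hP : ∀ u ∈ Metric.sphere 0 1, ∀ t ∈ Set.Icc 0 δ, P (X t u))
    {N : Set α → ℕ} (hN : ∀ Y, P Y → N Y < n) (hNflip : ∀ Y, N (flip Y) = N Y)
    {σ : Set α → ZMod 2} (hσflip : ∀ Y, P Y → σ (flip Y) = σ Y + 1)
    (hσ : ∀ Y Z, P Y → P Z → Y ⊆ Z → N Y = N Z → σ Y = σ Z) : False := by
  have hs (j : ℕ) (u) (hu : u ∈ Metric.sphere (0 : EuclideanSpace ℝ (Fin (n + 1))) 1)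
      (t : ℝ) (ht : t ∈ Set.Icc 0 δ) (hj : N (X t u) = j) :
      labelSign X N σ δ j u = σ (X t u) := by
    have h : ∃ t ∈ Set.Icc 0 δ, N (X t u) = j := ⟨t, ht, hj⟩
    obtain ⟨h1, h2⟩ := h.choose_spec
    rw [labelSign, dif_pos h]
    rcases le_total h.choose t with h3 | h3
    · exact hσ _ _ (hP u hu _ h1) (hP u hu t ht) (hX _ _ u u (by simpa using h3))
        (h2.trans hj.symm)
    · exact (hσ _ _ (hP u hu t ht) (hP u hu _ h1) (hX _ _ u u (by simpa using h3))
        (hj.trans h2.symm)).symm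
  have hodd (j : ℕ) (u) (hu : u ∈ Metric.sphere (0 : EuclideanSpace ℝ (Fin (n + 1))) 1) :
      labelSign X N σ δ j (-u) = labelSign X N σ δ j u + 1 := by
    by_cases h : ∃ t ∈ Set.Icc 0 δ, N (X t u) = j
    · obtain ⟨t, ht, hj⟩ := h
      rw [hs j u hu t ht hj, hs j (-u) (by simpa using hu) t ht (by rw [hflip, hNflip, hj]),
        hflip, hσflip _ (hP u hu t ht)]
    · have h' : ¬ ∃ t ∈ Set.Icc 0 δ, N (X t (-u)) = j := by
        simpa only [hflip, hNflip] using h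
      rw [labelSign, labelSign, dif_neg h, dif_neg h']
      refine oddSign_neg fun h => ne_zero_of_mem_unit_sphere ⟨u, hu⟩ ?_
      have h2 : (2 : ℝ) • u = 0 := by rw [two_smul, ← sub_neg_eq_add, ← h, sub_self]
      exact (smul_eq_zero.mp h2).resolve_left two_ne_zero
  set M := Nat.card α
  set η := δ / (2 * M + 2) with hη
  have hη0 : 0 < η := by positivity
  obtain ⟨l, hl, hsph, hd, hne⟩ := exists_small_list_nonconstant hodd hη0
  obtain ⟨u, hu⟩ := List.exists_mem_of_ne_nil l hl
  obtain ⟨q, hq, hqe⟩ := exists_eq_succ_of_monotone (f := fun q : ℕ => X (2 * q * η) u)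
    (fun a b hab => hX _ _ u u (by
      rw [dist_self, zero_add]
      have : (a : ℝ) ≤ b := by exact_mod_cast hab
      gcongr))
  have hqM : (q : ℝ) ≤ M := by exact_mod_cast hq
  have hδM : δ = (2 * M + 2) * η := by rw [hη]; field_simp
  have hconst (w) (hw : w ∈ l) : X ((2 * q + 1) * η) w = X (2 * q * η) u := by
    refine Set.Subset.antisymm ?_ ?_
    · rw [hqe]
      refine hX _ _ w u ?_
      push_cast
      linarith [hd w hw u hu]
    · refine hX _ _ u w ?_
      linarith [hd u hu w hw]
  have ht1 : (2 * q + 1) * η ∈ Set.Icc 0 δ := by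
    constructor
    · positivity
    · rw [hδM]
      gcongr
      linarith
  have hPu : P (X (2 * q * η) u) := hconst u hu ▸ hP u (hsph u hu) _ ht1
  obtain ⟨v, hv, w, hw, hvw⟩ := hne _ (hN _ hPu)
  rw [hs _ v (hsph v hv) _ ht1 (by rw [hconst v hv]),
    hs _ w (hsph w hw) _ ht1 (by rw [hconst w hw]), hconst v hv, hconst w hw] at hvw
  exact hvw rfl

end Thresholds

section Near

/-- The real number `±1` encoded by a sign. -/
def signOf (b : Bool) : ℝ := if b then 1 else -1

lemma abs_signOf (b : Bool) : |signOf b| = 1 := by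
  cases b <;> simp [signOf]

lemma signOf_not (b : Bool) : signOf (!b) = -signOf b := by
  cases b <;> simp [signOf]

variable {E ι : Type*} [NormedAddCommGroup E] [NormedSpace ℝ E]

/-- The pairs `(i, ±)` such that `±u` is within distance `t` of a point of `F i`. -/
def near (F : ι → Set E) (t : ℝ) (u : E) : Set (ι × Bool) :=
  {x | ∃ y ∈ F x.1, dist (signOf x.2 • u) y ≤ t}

lemma dist_signOf_smul (b : Bool) (u v : E) :
    dist (signOf b • u) (signOf b • v) = dist u v := by
  rw [dist_smul₀, Real.norm_eq_abs, abs_signOf, one_mul]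

lemma near_subset_near (F : ι → Set E) {t t' : ℝ} {u v : E} (h : dist u v + t ≤ t') :
    near F t u ⊆ near F t' v := by
  rintro x ⟨y, hy, hd⟩
  refine ⟨y, hy, (dist_triangle _ (signOf x.2 • u) _).trans ?_⟩
  rw [dist_signOf_smul, dist_comm v u]
  linarith

lemma near_neg (F : ι → Set E) (t : ℝ) (u : E) : near F t (-u) = flipSigns (near F t u) := by
  ext x
  simp [near, flipSigns, signOf_not]

lemma mem_near_zero {F : ι → Set E} {u : E} {x : ι × Bool} :
    x ∈ near F 0 u ↔ signOf x.2 • u ∈ F x.1 := by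
  constructor
  · rintro ⟨y, hy, hd⟩
    rwa [dist_le_zero.mp hd]
  · exact fun h => ⟨_, h, (dist_self _).le⟩

lemma exists_pos_near_subset [Finite ι] {F : ι → Set E} (hF : ∀ i, IsClosed (F i)) {K : Set E}
    (hK : IsCompact K) : ∃ δ > 0, ∀ u ∈ K, ∃ v ∈ K, near F δ u ⊆ near F 0 v := by
  have key (Y : Set (ι × Bool)) :
      ∃ δ > 0, (∃ u ∈ K, Y ⊆ near F δ u) → ∃ v ∈ K, Y ⊆ near F 0 v := by
    by_cases h : ∃ v ∈ K, Y ⊆ near F 0 v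
    · exact ⟨1, one_pos, fun _ => h⟩
    push Not at h
    suffices ∃ δ > 0, ∀ u ∈ K, ¬ Y ⊆ near F δ u by
      obtain ⟨δ, h1, h2⟩ := this
      exact ⟨δ, h1, fun ⟨u, hu, hY⟩ => absurd hY (h2 u hu)⟩
    refine hK.induction_on (p := fun s => ∃ δ > 0, ∀ u ∈ s, ¬ Y ⊆ near F δ u)
      ⟨1, one_pos, by simp⟩ ?_ ?_ ?_
    · rintro s t hst ⟨δ, h1, h2⟩
      exact ⟨δ, h1, fun u hu => h2 u (hst hu)⟩
    · rintro s t ⟨δ, h1, h2⟩ ⟨δ', h1', h2'⟩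
      refine ⟨min δ δ', lt_min h1 h1', ?_⟩
      rintro u (hu | hu) hY
      · exact h2 u hu (hY.trans (near_subset_near F (by simp)))
      · exact h2' u hu (hY.trans (near_subset_near F (by simp)))
    · intro u hu
      obtain ⟨x, hx, hxn⟩ := Set.not_subset.mp (h u hu)
      rw [mem_near_zero] at hxn
      obtain ⟨r, hr, hball⟩ := Metric.isOpen_iff.mp (hF x.1).isOpen_compl _ hxn
      refine ⟨_, mem_nhdsWithin_of_mem_nhds (Metric.ball_mem_nhds u (half_pos hr)), r / 2,
        half_pos hr, fun v hv hY => ?_⟩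
      obtain ⟨y, hy, hd⟩ := hY hx
      refine hball (?_ : dist y _ < r) hy
      have h1 := dist_triangle y (signOf x.2 • v) (signOf x.2 • u)
      rw [dist_signOf_smul, dist_comm y (signOf x.2 • v)] at h1
      have h2 : dist v u < r / 2 := hv
      linarith
  choose δ hδ hY using key
  obtain ⟨Y₀, hY₀⟩ := Finite.exists_min δ
  refine ⟨δ Y₀, hδ Y₀, fun u hu => hY _ ⟨u, hu, ?_⟩⟩
  exact near_subset_near F (by simpa using hY₀ _)

end Near

section Patterns

variable {ι : Type*}

lemma rel_of_lt {α : Type*} {r : α → α → Prop} [IsTrans α r] {y : ℕ → α} {p : ℕ}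
    (h : ∀ i < p, r (y i) (y (i + 1))) {i j : ℕ} (hij : i < j) (hj : j ≤ p) : r (y i) (y j) := by
  induction j, hij using Nat.le_induction with
  | base => exact h i hj
  | succ j hij ih => exact trans_of r (ih (by omega)) (h j hj)

lemma EndsChain.exists_pattern {r₁ r₂ : ι → ι → Prop} [IsTrans ι r₁] [IsTrans ι r₂]
    {Y : Set (ι × Bool)} {p : ℕ} {x : ι × Bool} (hx : EndsChain (altRel r₁ r₂) Y p x) :
    ∃ (b : Bool) (g : Fin (p + 1) → ι),
      (∀ i : Fin (p + 1), ∃ c, (g i, c) ∈ Y ∧ signOf c = signOf b * (-1) ^ (i : ℕ)) ∧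
      (∀ i j, i < j → r₁ (g i) (g j)) ∧ ∀ i j, i < j → r₂ (g i) (g j) := by
  obtain ⟨y, h1, h2, -⟩ := hx.exists_seq
  refine ⟨(y 0).2, fun i => (y i).1, fun i => ⟨(y i).2, h1 i (by omega), ?_⟩,
    fun i j hij => ?_, fun i j hij => ?_⟩
  · have key (k : ℕ) (hk : k ≤ p) : signOf (y k).2 = signOf (y 0).2 * (-1) ^ k := by
      induction k with
      | zero => simp
      | succ k ih =>
        rw [(h2 k hk).2.2, signOf_not, ih (by omega), pow_succ]
        ring
    exact key i (by omega)
  · exact rel_of_lt (y := fun i => (y i).1) (fun i hi => (h2 i hi).1) hij (by omega)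
  · exact rel_of_lt (y := fun i => (y i).1) (fun i hi => (h2 i hi).2.1) hij (by omega)

end Patterns

end KyFan

/-- Ky Fan's covering lemma for two linear orders: for a finite closed
antipodal-free cover of `S^n` with two linear orders, some point witnesses an
alternating pattern of length at least `((n+1)/2)^(1/2)` that is monotone with
respect to both orders. -/
theorem kyFan_two_orders {n : ℕ} {ι : Type*} [Fintype ι]
    (lt₁ lt₂ : ι → ι → Prop)
    (h₁ : IsStrictTotalOrder ι lt₁) (h₂ : IsStrictTotalOrder ι lt₂)
    (F : ι → Set (EuclideanSpace ℝ (Fin (n + 1))))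
    (hclosed : ∀ i, IsClosed (F i))
    (hsub : ∀ i, F i ⊆ Metric.sphere (0 : EuclideanSpace ℝ (Fin (n + 1))) 1)
    (hcover : Metric.sphere (0 : EuclideanSpace ℝ (Fin (n + 1))) 1 ⊆ ⋃ i, F i)
    (hanti : ∀ i, F i ∩ (-F i) = ∅) :
    ∃ u ∈ Metric.sphere (0 : EuclideanSpace ℝ (Fin (n + 1))) 1,
      ∃ ε : ℝ, (ε = 1 ∨ ε = -1) ∧
      ∃ m : ℕ, Real.sqrt ((n + 1) / 2) ≤ (m : ℝ) ∧
      ∃ g : Fin m → ι,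
        (∀ i : Fin m, (ε * (-1 : ℝ) ^ (i : ℕ)) • u ∈ F (g i)) ∧
        ((∀ i j : Fin m, i < j → lt₁ (g i) (g j)) ∨
          (∀ i j : Fin m, i < j → lt₁ (g j) (g i))) ∧
        ((∀ i j : Fin m, i < j → lt₂ (g i) (g j)) ∨
          (∀ i j : Fin m, i < j → lt₂ (g j) (g i))) := by
  by_contra hcon
  set p := Nat.sqrt n with hp
  have hm : Real.sqrt ((n + 1) / 2) ≤ ((p + 1 : ℕ) : ℝ) := by
    rw [Real.sqrt_le_iff]
    refine ⟨by positivity, ?_⟩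
    have h1 : ((n + 1 : ℕ) : ℝ) ≤ ((p + 1) * (p + 1) : ℕ) :=
      Nat.cast_le.mpr (Nat.succ_le_of_lt (Nat.lt_succ_sqrt n))
    push_cast at h1 ⊢
    have : (0 : ℝ) ≤ n := n.cast_nonneg
    linarith
  have hpattern (r : ι → ι → Prop) [IsTrans ι r] (hr : r = lt₂ ∨ r = Function.swap lt₂)
      (u) (hu : u ∈ Metric.sphere (0 : EuclideanSpace ℝ (Fin (n + 1))) 1) (x) :
      ¬ KyFan.EndsChain (KyFan.altRel lt₁ r) (KyFan.near F 0 u) p x := by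
    intro hx
    obtain ⟨b, g, hg1, hg2, hg3⟩ := hx.exists_pattern
    refine hcon ⟨u, hu, KyFan.signOf b, by cases b <;> simp [KyFan.signOf], p + 1, hm, g,
      fun i => ?_, Or.inl hg2, ?_⟩
    · obtain ⟨c, hc1, hc2⟩ := hg1 i
      rw [← hc2]
      exact KyFan.mem_near_zero.mp hc1
    · rcases hr with rfl | rfl
      · exact Or.inl hg3
      · exact Or.inr hg3
  obtain ⟨δ, hδ, hnear⟩ :=
    KyFan.exists_pos_near_subset hclosed (isCompact_sphere (0 : EuclideanSpace ℝ (Fin (n + 1))) 1)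
  have hadm (u) (hu : u ∈ Metric.sphere (0 : EuclideanSpace ℝ (Fin (n + 1))) 1) (t : ℝ)
      (ht : t ∈ Set.Icc 0 δ) : KyFan.Admissible lt₁ lt₂ p (KyFan.near F t u) := by
    obtain ⟨v, hv, hδv⟩ := hnear u hu
    have hsubset : KyFan.near F t u ⊆ KyFan.near F 0 v :=
      (KyFan.near_subset_near F (by simpa using ht.2)).trans hδv
    refine ⟨?_, fun i hi hi' => ?_, fun x hx => ?_, fun x hx => ?_⟩
    · obtain ⟨i, hi⟩ := Set.mem_iUnion.mp (hcover hu)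
      exact ⟨(i, true), u, hi, by simpa [KyFan.signOf] using ht.1⟩
    · have h3 := KyFan.mem_near_zero.mp (hsubset hi)
      have h4 := KyFan.mem_near_zero.mp (hsubset hi')
      simp only [KyFan.signOf, if_true, one_smul, Bool.false_eq_true, if_false, neg_smul]
        at h3 h4
      exact Set.notMem_empty v (hanti i ▸ ⟨h3, h4⟩)
    · exact hpattern lt₂ (Or.inl rfl) v hv x (hx.mono hsubset)
    · have : IsTrans ι (Function.swap lt₂) := ⟨fun a b c hab hbc => trans_of lt₂ hbc hab⟩
      exact hpattern _ (Or.inr rfl) v hv x (hx.mono hsubset)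
  refine KyFan.false_of_labelling hδ (fun t t' u v h => KyFan.near_subset_near F h)
    (KyFan.near_neg F) hadm
    (N := fun Y => (KyFan.chainLengths lt₁ lt₂ p Y).card - 1)
    (fun Y hY => hY.card_chainLengths_sub_one_lt.trans_le (Nat.sqrt_le n))
    (fun Y => by simp only [KyFan.chainLengths_flipSigns])
    (σ := KyFan.cornerSign lt₁ lt₂ p)
    (fun Y hY => hY.cornerSign_flipSigns)
    (fun Y Z hY hZ hYZ h => hY.cornerSign_eq_of_subset hZ hYZ ?_)
  have := hY.chainLengths_nonempty.card_pos
  have := hZ.chainLengths_nonempty.card_pos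
  omega
end
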